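/- For any positive integers k and B, the equation d_k(n) = d_k(n+B) has infinitely many solutions n, i.e., there exist infinitely many positive integers n such that the number of divisors of n coprime to k equals the number of divisors of n+B coprime to k. -/

import Mathlib

/-- `dk k n` is the number of divisors `m` of `n` with `gcd(m, k) = 1`. -/
def dk (k n : ℕ) : ℕ := (n.divisors.filter fun m => Nat.gcd m k = 1).card

theorem dk_mul {k m n : ℕ} (h : m.Coprime n) : dk k (m * n) = dk k m * dk k n := by
  classical
  unfold dk
  have himg : ((m * n).divisors.filter fun d => Nat.gcd d k = 1) =
      ((m.divisors.filter fun d => Nat.gcd d k = 1) ×ˢ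
        (n.divisors.filter fun d => Nat.gcd d k = 1)).image fun p : ℕ × ℕ => p.1 * p.2 := by
    ext d
    rw [Nat.divisors_mul]
    simp only [Finset.mem_filter, Finset.mem_mul, Finset.mem_image, Finset.mem_product, Prod.exists]
    constructor
    · rintro ⟨⟨a, ha, b, hb, rfl⟩, hd⟩
      exact ⟨a, b, ⟨⟨ha, Nat.Coprime.coprime_mul_right hd⟩,
        ⟨hb, Nat.Coprime.coprime_mul_left hd⟩⟩, rfl⟩
    · rintro ⟨a, b, ⟨⟨ha, ha'⟩, ⟨hb, hb'⟩⟩, rfl⟩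
      exact ⟨⟨a, ha, b, hb, rfl⟩, Nat.Coprime.mul_left ha' hb'⟩
  rw [himg, Finset.card_image_of_injOn, Finset.card_product]
  refine h.mul_injOn_divisors.mono fun p hp => ?_
  simp only [Finset.coe_product, Set.mem_prod, Finset.mem_coe, Finset.coe_filter,
    Set.mem_ofPred_eq] at hp ⊢
  exact ⟨hp.1.1, hp.2.1⟩

theorem dk_eq_card_divisors {k n : ℕ} (h : n.Coprime k) : dk k n = n.divisors.card := by
  unfold dk
  rw [Finset.filter_true_of_mem]
  intro d hd
  exact Nat.Coprime.coprime_dvd_left (Nat.dvd_of_mem_divisors hd) h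

theorem dk_pos {k n : ℕ} (hn : 0 < n) : 0 < dk k n :=
  Finset.card_pos.2 ⟨1, by simp [hn.ne']⟩

theorem dk_prime_pow {k p e : ℕ} (hp : p.Prime) (h : ¬p ∣ k) : dk k (p ^ e) = e + 1 := by
  rw [dk_eq_card_divisors (((Nat.Prime.coprime_iff_not_dvd hp).2 h).pow_left e),
    Nat.divisors_prime_pow hp]
  simp

theorem dk_of_squarefree {k n : ℕ} (hn : Squarefree n) (h : n.Coprime k) :
    dk k n = 2 ^ n.primeFactors.card := by
  rw [dk_eq_card_divisors h, Nat.card_divisors hn.ne_zero]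
  refine Finset.prod_eq_pow_card fun p hp => ?_
  have h1 := (Nat.squarefree_iff_factorization_le_one hn.ne_zero).1 hn p
  have h2 := (Nat.prime_of_mem_primeFactors hp).factorization_pos_of_dvd hn.ne_zero
    (Nat.dvd_of_mem_primeFactors hp)
  omega

/-- `F` has average `m / q`, up to a total error `E`, over the `n < X` in every residue class
whose modulus `q` is coprime to all elements of `S`. -/
def HasClassMean (X : ℕ) (S : Finset ℕ) (F : ℕ → ℝ) (m E : ℝ) : Prop :=
  ∀ q c : ℕ, 0 < q → (∀ p ∈ S, p.Coprime q) →
    |∑ n ∈ (Finset.range X).filter (fun n => n ≡ c [MOD q]), F n - X * m / q| ≤ E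

namespace HasClassMean

theorem one (X : ℕ) : HasClassMean X ∅ (fun _ => 1) 1 1 := by
  intro q c hq _
  rw [Finset.sum_const, nsmul_eq_mul, mul_one, mul_one, ← Nat.count_eq_card_filter_range,
    Nat.count_modEq_card _ hq]
  have hq' : (0 : ℝ) < q := by exact_mod_cast hq
  have h1 : (X : ℝ) / q < ((X / q : ℕ) : ℝ) + 1 := by
    rw [div_lt_iff₀ hq']
    exact_mod_cast (mul_comm q _ ▸ Nat.lt_mul_div_succ X hq : X < (X / q + 1) * q)
  have h2 : ((X / q : ℕ) : ℝ) ≤ (X : ℝ) / q := Nat.cast_div_le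
  rw [abs_le]
  split_ifs <;> constructor <;> push_cast <;> linarith

theorem sum {ι : Type*} {X : ℕ} {S : Finset ℕ} (K : Finset ι) (a : ι → ℝ) {F : ι → ℕ → ℝ}
    {m E : ι → ℝ} (h : ∀ k ∈ K, HasClassMean X S (F k) (m k) (E k)) :
    HasClassMean X S (fun n => ∑ k ∈ K, a k * F k n) (∑ k ∈ K, a k * m k)
      (∑ k ∈ K, |a k| * E k) := by
  intro q c hq hS
  rw [Finset.sum_comm, Finset.mul_sum, Finset.sum_div, ← Finset.sum_sub_distrib]
  refine (Finset.abs_sum_le_sum_abs _ _).trans (Finset.sum_le_sum fun k hk => ?_)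
  rw [← Finset.mul_sum]
  have := h k hk q c hq hS
  calc _ = |a k * (∑ n ∈ (Finset.range X).filter (fun n => n ≡ c [MOD q]), F k n
        - X * m k / q)| := by congr 1; ring
    _ ≤ _ := by rw [abs_mul]; gcongr

theorem mono_set {X : ℕ} {S T : Finset ℕ} {F : ℕ → ℝ} {m E : ℝ} (h : HasClassMean X S F m E)
    (hST : S ⊆ T) : HasClassMean X T F m E :=
  fun q c hq hT => h q c hq fun p hp => hT p (hST hp)

open Classical in
theorem mul_indicator {X N : ℕ} {S : Finset ℕ} {F : ℕ → ℝ} {m E : ℝ}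
    (h : HasClassMean X S F m E) {p : ℕ} (hp : p.Prime) (hpS : ∀ q ∈ S, q.Coprime p)
    {P : ℕ → Prop} {r : Fin N → ℕ} (hP : ∀ n, P n ↔ ∃ i, n ≡ r i [MOD p])
    (hr : ∀ i j, r i ≡ r j [MOD p] → i = j) :
    HasClassMean X (insert p S) (fun n => F n * if P n then 1 else 0) (m * (N / p)) (E * N) := by
  intro q c hq hS
  have hpq : q.Coprime p := (hS p (Finset.mem_insert_self _ _)).symm
  have hcrt : ∀ i : Fin N, ∃ d, d ≡ c [MOD q] ∧ d ≡ r i [MOD p] := fun i =>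
    ⟨Nat.chineseRemainder hpq c (r i), (Nat.chineseRemainder hpq c (r i)).2⟩
  choose d hd1 hd2 using hcrt
  have hsum : ∑ n ∈ (Finset.range X).filter (fun n => n ≡ c [MOD q]),
      (F n * if P n then 1 else 0) =
      ∑ i : Fin N, ∑ n ∈ (Finset.range X).filter (fun n => n ≡ d i [MOD (q * p)]), F n := by
    simp only [mul_ite, mul_one, mul_zero]
    rw [← Finset.sum_filter, ← Finset.sum_biUnion]
    · refine Finset.sum_congr ?_ fun _ _ => rfl
      ext n
      simp only [Finset.mem_filter, Finset.mem_biUnion, Finset.mem_univ, true_and, hP]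
      constructor
      · rintro ⟨⟨hn, hc⟩, i, hi⟩
        exact ⟨i, hn, (Nat.modEq_and_modEq_iff_modEq_mul hpq).1
          ⟨hc.trans (hd1 i).symm, hi.trans (hd2 i).symm⟩⟩
      · rintro ⟨i, hn, hi⟩
        have := (Nat.modEq_and_modEq_iff_modEq_mul hpq).2 hi
        exact ⟨⟨hn, this.1.trans (hd1 i)⟩, i, this.2.trans (hd2 i)⟩
    · intro i _ j _ hij
      rw [Function.onFun, Finset.disjoint_left]
      intro n hi hj
      rw [Finset.mem_filter] at hi hj
      refine hij (hr i j ?_)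
      have h1 := ((Nat.modEq_and_modEq_iff_modEq_mul hpq).2 hi.2).2.trans (hd2 i)
      have h2 := ((Nat.modEq_and_modEq_iff_modEq_mul hpq).2 hj.2).2.trans (hd2 j)
      exact h1.symm.trans h2
  have hmain : (X : ℝ) * (m * (N / p)) / q = ∑ i : Fin N, X * m / ((q * p : ℕ) : ℝ) := by
    rw [Finset.sum_const, Finset.card_univ, Fintype.card_fin, nsmul_eq_mul]
    have : (q : ℝ) ≠ 0 := by exact_mod_cast hq.ne'
    have : (p : ℝ) ≠ 0 := by exact_mod_cast hp.ne_zero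
    push_cast
    field_simp
  rw [hsum, hmain, ← Finset.sum_sub_distrib]
  refine (Finset.abs_sum_le_sum_abs _ _).trans ?_
  calc _ ≤ ∑ i : Fin N, E := Finset.sum_le_sum fun i _ => h (q * p) (d i)
        (Nat.mul_pos hq hp.pos) fun x hx =>
          Nat.Coprime.mul_right (hS x (Finset.mem_insert_of_mem hx)) (hpS x hx)
    _ = E * N := by simp [mul_comm]

end HasClassMean

/-- Every prime in `Q` has exactly `N` residue classes on which `hit p` holds. -/
def HasRoots (N : ℕ) (hit : ℕ → ℕ → Prop) (p : ℕ) : Prop :=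
  p.Prime ∧ ∃ r : Fin N → ℕ, (∀ n, hit p n ↔ ∃ i, n ≡ r i [MOD p]) ∧
    ∀ i j, r i ≡ r j [MOD p] → i = j

open Classical in
/-- A polynomial in the number of `p ∈ Q` with `hit p n`: the sum of `g |s|` over the sets `s ⊆ Q`
of such `p`. -/
noncomputable def blockWeight (hit : ℕ → ℕ → Prop) (Q : Finset ℕ) (g : ℕ → ℝ) (n : ℕ) : ℝ :=
  ∑ s ∈ Q.powerset, g s.card * if ∀ p ∈ s, hit p n then 1 else 0

/-- The mean value of `blockWeight`. -/
noncomputable def blockMean (x : ℕ → ℝ) (Q : Finset ℕ) (g : ℕ → ℝ) : ℝ :=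
  ∑ s ∈ Q.powerset, g s.card * ∏ p ∈ s, x p

/-- The number of residue classes, counted with weights, that `blockWeight` involves. -/
noncomputable def blockError (N : ℕ) (Q : Finset ℕ) (g : ℕ → ℝ) : ℝ :=
  ∑ s ∈ Q.powerset, |g s.card| * (N : ℝ) ^ s.card

namespace HasClassMean

open Classical in
theorem mul_subset {X N : ℕ} {S : Finset ℕ} {F : ℕ → ℝ} {m E : ℝ} {hit : ℕ → ℕ → Prop}
    (h : HasClassMean X S F m E) (hS : ∀ q ∈ S, q.Prime) (s : Finset ℕ)
    (hs : ∀ p ∈ s, HasRoots N hit p) (hd : Disjoint S s) :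
    HasClassMean X (S ∪ s) (fun n => F n * if ∀ p ∈ s, hit p n then 1 else 0)
      (m * ∏ p ∈ s, (N / p : ℝ)) (E * (N : ℝ) ^ s.card) := by
  induction s using Finset.induction_on with
  | empty => simpa using h
  | insert p s hps ih =>
    obtain ⟨hp, r, hr, hr'⟩ := hs p (Finset.mem_insert_self _ _)
    have hd' : Disjoint S s := hd.mono_right (Finset.subset_insert _ _)
    have := (ih (fun q hq => hs q (Finset.mem_insert_of_mem hq)) hd').mul_indicator hp
      (fun q hq => ?_) hr hr'
    · rw [Finset.prod_insert hps, Finset.card_insert_of_notMem hps, Finset.union_insert]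
      convert this using 1
      · ext n
        simp only [Finset.forall_mem_insert]
        by_cases h1 : hit p n <;> by_cases h2 : ∀ p ∈ s, hit p n <;> simp [h1, h2]
      · ring
      · ring
    · have hne : q ≠ p := by
        rintro rfl
        rcases Finset.mem_union.1 hq with hq | hq
        · exact Finset.disjoint_left.1 hd hq (Finset.mem_insert_self _ _)
        · exact hps hq
      refine (Nat.coprime_primes ?_ hp).2 hne
      rcases Finset.mem_union.1 hq with hq | hq
      · exact hS q hq
      · exact (hs q (Finset.mem_insert_of_mem hq)).1

theorem mul_blockWeight {X N : ℕ} {S : Finset ℕ} {F : ℕ → ℝ} {m E : ℝ} {hit : ℕ → ℕ → Prop}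
    (h : HasClassMean X S F m E) (hS : ∀ q ∈ S, q.Prime) (Q : Finset ℕ)
    (hQ : ∀ p ∈ Q, HasRoots N hit p) (hd : Disjoint S Q) (g : ℕ → ℝ) :
    HasClassMean X (S ∪ Q) (fun n => F n * blockWeight hit Q g n)
      (m * blockMean (fun p => N / p) Q g) (E * blockError N Q g) := by
  classical
  have := HasClassMean.sum Q.powerset (fun s => g s.card) fun s hs =>
    (h.mul_subset hS s (fun p hp => hQ p (Finset.mem_powerset.1 hs hp))
      (hd.mono_right (Finset.mem_powerset.1 hs))).mono_set
      (Finset.union_subset_union_right (Finset.mem_powerset.1 hs))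
  convert this using 1
  · ext n
    rw [blockWeight, Finset.mul_sum]
    refine Finset.sum_congr rfl fun s _ => ?_
    split_ifs <;> ring
  · rw [blockMean, Finset.mul_sum]
    exact Finset.sum_congr rfl fun s _ => by ring
  · rw [blockError, Finset.mul_sum]
    exact Finset.sum_congr rfl fun s _ => by ring

theorem prod_blockWeight {ι : Type*} {X N : ℕ} {hit : ℕ → ℕ → Prop} (J : Finset ι)
    (Q : ι → Finset ℕ) (hQ : ∀ j ∈ J, ∀ p ∈ Q j, HasRoots N hit p)
    (hd : (J : Set ι).PairwiseDisjoint Q) (g : ι → ℕ → ℝ) :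
    HasClassMean X (J.biUnion Q) (fun n => ∏ j ∈ J, blockWeight hit (Q j) (g j) n)
      (∏ j ∈ J, blockMean (fun p => N / p) (Q j) (g j)) (∏ j ∈ J, blockError N (Q j) (g j)) := by
  classical
  induction J using Finset.induction_on with
  | empty => simpa using one X
  | insert j J hj ih =>
    have hd' : (J : Set ι).PairwiseDisjoint Q :=
      hd.subset (by simp)
    have := (ih (fun i hi => hQ i (Finset.mem_insert_of_mem hi)) hd').mul_blockWeight
      (fun q hq => ?_) (Q j) (hQ j (Finset.mem_insert_self _ _)) ?_ (g j)
    · rw [Finset.prod_insert hj, Finset.prod_insert hj, Finset.biUnion_insert, Finset.union_comm]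
      convert this using 1
      · ext n
        rw [Finset.prod_insert hj, mul_comm]
      · ring
      · ring
    · obtain ⟨i, hi, hq⟩ := Finset.mem_biUnion.1 hq
      exact (hQ i (Finset.mem_insert_of_mem hi) q hq).1
    · rw [Finset.disjoint_biUnion_left]
      intro i hi
      exact hd (by simp [hi]) (by simp) (by rintro rfl; exact hj hi)

end HasClassMean

open Classical in
/-- The number of `p ∈ Q` with `hit p n`. -/
noncomputable def hitCount (hit : ℕ → ℕ → Prop) (Q : Finset ℕ) (n : ℕ) : ℕ :=
  (Q.filter fun p => hit p n).card

theorem blockWeight_eq (hit : ℕ → ℕ → Prop) (Q : Finset ℕ) (g : ℕ → ℝ) (n : ℕ) :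
    blockWeight hit Q g n =
      ∑ r ∈ Finset.range (hitCount hit Q n + 1), ((hitCount hit Q n).choose r : ℝ) * g r := by
  classical
  unfold blockWeight hitCount
  simp only [mul_ite, mul_one, mul_zero, ← nsmul_eq_mul]
  rw [← Finset.sum_powerset_apply_card, ← Finset.sum_filter]
  refine Finset.sum_congr ?_ fun _ _ => rfl
  ext s
  simp only [Finset.mem_filter, Finset.mem_powerset, Finset.subset_iff]
  exact ⟨fun h p hp => ⟨h.1 hp, h.2 p hp⟩, fun h => ⟨fun p hp => (h hp).1, fun p hp => (h hp).2⟩⟩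

/-- Coefficients of the inclusion-exclusion sum truncated after `2 * b` terms. -/
noncomputable def bonferroniCoeff (b r : ℕ) : ℝ := if r ≤ 2 * b then (-1) ^ r else 0

/-- Coefficients of the truncated inclusion-exclusion sum multiplied by the number of hits. -/
noncomputable def bonferroniMulCoeff (b r : ℕ) : ℝ := if r = 2 * b + 1 then 2 * b + 1 else 0

theorem sum_choose_mul_bonferroniCoeff (b t : ℕ) :
    ∑ r ∈ Finset.range (t + 1), (t.choose r : ℝ) * bonferroniCoeff b r =
      if t = 0 then 1 else ((t - 1).choose (2 * b) : ℝ) := by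
  rcases t with _ | t
  · simp [bonferroniCoeff]
  have h : ∑ r ∈ Finset.range (t + 1 + 1), ((t + 1).choose r : ℝ) * bonferroniCoeff b r =
      ∑ r ∈ Finset.range (2 * b + 1), (-1 : ℝ) ^ r * ((t + 1).choose r : ℝ) := by
    simp only [bonferroniCoeff, mul_ite, mul_zero]
    rw [← Finset.sum_filter, ← Finset.sum_subset (s₁ := (Finset.range (t + 1 + 1)).filter
      fun r => r ≤ 2 * b) (s₂ := Finset.range (2 * b + 1))]
    · exact Finset.sum_congr rfl fun r _ => mul_comm _ _
    · intro r hr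
      simp only [Finset.mem_filter, Finset.mem_range] at hr ⊢
      omega
    · intro r hr hr'
      simp only [Finset.mem_filter, Finset.mem_range] at hr hr'
      rw [Nat.choose_eq_zero_of_lt (by omega)]
      simp
  have h2 := @Int.alternating_sum_range_choose_eq_choose t (2 * b)
  rw [h, if_neg (Nat.succ_ne_zero t)]
  have h3 : ((∑ k ∈ Finset.range (2 * b + 1), ((-1) ^ k * (t + 1).choose k : ℤ) : ℤ) : ℝ) =
      (((-1) ^ (2 * b) * t.choose (2 * b) : ℤ) : ℝ) := by rw [h2]
  push_cast at h3
  rw [h3]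
  simp

theorem sum_choose_mul_bonferroniMulCoeff (b t : ℕ) :
    ∑ r ∈ Finset.range (t + 1), (t.choose r : ℝ) * bonferroniMulCoeff b r =
      t * ∑ r ∈ Finset.range (t + 1), (t.choose r : ℝ) * bonferroniCoeff b r := by
  rw [sum_choose_mul_bonferroniCoeff]
  simp only [bonferroniMulCoeff, mul_ite, mul_zero]
  rw [Finset.sum_ite_eq']
  rcases t with _ | t
  · simp
  have h := Nat.add_one_mul_choose_eq t (2 * b)
  have h' : ((t : ℝ) + 1) * (t.choose (2 * b)) = ((t + 1).choose (2 * b + 1)) * (2 * b + 1) := by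
    exact_mod_cast h
  simp only [Finset.mem_range, Nat.add_one_ne_zero, if_false, Nat.add_sub_cancel]
  split_ifs with hlt
  · push_cast
    linarith
  · rw [Nat.choose_eq_zero_of_lt (by omega : t < 2 * b)]
    simp

theorem blockWeight_bonferroniCoeff_nonneg (hit : ℕ → ℕ → Prop) (Q : Finset ℕ) (b n : ℕ) :
    0 ≤ blockWeight hit Q (bonferroniCoeff b) n := by
  rw [blockWeight_eq, sum_choose_mul_bonferroniCoeff]
  split_ifs <;> positivity

theorem blockWeight_bonferroniCoeff_eq_one {hit : ℕ → ℕ → Prop} {Q : Finset ℕ} (b : ℕ) {n : ℕ}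
    (h : hitCount hit Q n = 0) : blockWeight hit Q (bonferroniCoeff b) n = 1 := by
  rw [blockWeight_eq, sum_choose_mul_bonferroniCoeff, if_pos h]

theorem blockWeight_bonferroniMulCoeff (hit : ℕ → ℕ → Prop) (Q : Finset ℕ) (b n : ℕ) :
    blockWeight hit Q (bonferroniMulCoeff b) n =
      hitCount hit Q n * blockWeight hit Q (bonferroniCoeff b) n := by
  rw [blockWeight_eq, blockWeight_eq, sum_choose_mul_bonferroniMulCoeff]

theorem blockMean_insert (x : ℕ → ℝ) {Q : Finset ℕ} {p : ℕ} (hp : p ∉ Q) (g : ℕ → ℝ) :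
    blockMean x (insert p Q) g =
      blockMean x Q g + x p * blockMean x Q (fun r => g (r + 1)) := by
  classical
  unfold blockMean
  rw [Finset.sum_powerset_insert hp, Finset.mul_sum]
  congr 1
  refine Finset.sum_congr rfl fun s hs => ?_
  have : p ∉ s := fun h => hp (Finset.mem_powerset.1 hs h)
  rw [Finset.card_insert_of_notMem this, Finset.prod_insert this]
  ring

theorem blockMean_alternating (x : ℕ → ℝ) (Q : Finset ℕ) (hx : ∀ p ∈ Q, 0 ≤ x p)
    (hx1 : ∀ p ∈ Q, x p ≤ 1) :
    ∀ b : ℕ, blockMean x Q (fun r => if r < 2 * b then (-1) ^ r else 0) ≤ ∏ p ∈ Q, (1 - x p) ∧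
      ∏ p ∈ Q, (1 - x p) ≤ blockMean x Q (fun r => if r < 2 * b + 1 then (-1) ^ r else 0) := by
  classical
  induction Q using Finset.induction_on with
  | empty =>
    intro b
    simp only [blockMean, Finset.powerset_empty, Finset.sum_singleton, Finset.card_empty,
      Finset.prod_empty]
    split_ifs <;> simp_all
  | insert p Q hp ih =>
    have hx' : ∀ q ∈ Q, 0 ≤ x q := fun q hq => hx q (Finset.mem_insert_of_mem hq)
    have hx1' : ∀ q ∈ Q, x q ≤ 1 := fun q hq => hx1 q (Finset.mem_insert_of_mem hq)
    have hxp := hx p (Finset.mem_insert_self _ _)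
    have key : ∀ c : ℕ, blockMean x (insert p Q) (fun r => if r < c + 1 then (-1) ^ r else 0) =
        blockMean x Q (fun r => if r < c + 1 then (-1) ^ r else 0) -
          x p * blockMean x Q (fun r => if r < c then (-1) ^ r else 0) := by
      intro c
      rw [blockMean_insert x hp, sub_eq_add_neg, ← mul_neg]
      congr 2
      rw [blockMean, blockMean, ← Finset.sum_neg_distrib]
      refine Finset.sum_congr rfl fun s _ => ?_
      simp only [Nat.add_lt_add_iff_right, pow_succ]
      split_ifs <;> ring
    intro b
    rw [Finset.prod_insert hp]
    have h1 := (ih hx' hx1' b).1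
    have h2 := (ih hx' hx1' b).2
    constructor
    · rcases b with _ | b
      · have h0 : ∀ R : Finset ℕ,
            blockMean x R (fun r => if r < 2 * 0 then (-1) ^ r else 0) = 0 := by
          intro R
          simp [blockMean]
        rw [h0, ← Finset.prod_insert hp (f := fun q => 1 - x q)]
        exact Finset.prod_nonneg fun q hq => sub_nonneg.2 (hx1 q hq)
      · rw [show 2 * (b + 1) = (2 * b + 1) + 1 by ring, key]
        have h3 := (ih hx' hx1' b).2
        rw [show 2 * (b + 1) = (2 * b + 1) + 1 by ring] at h1
        nlinarith
    · rw [key]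
      nlinarith

theorem prod_one_sub_le_blockMean_bonferroniCoeff (x : ℕ → ℝ) (Q : Finset ℕ)
    (hx : ∀ p ∈ Q, 0 ≤ x p) (hx1 : ∀ p ∈ Q, x p ≤ 1) (b : ℕ) :
    ∏ p ∈ Q, (1 - x p) ≤ blockMean x Q (bonferroniCoeff b) := by
  have h := (blockMean_alternating x Q hx hx1 b).2
  simp only [Nat.lt_add_one_iff] at h
  exact h

theorem blockMean_single_mul_factorial_le (x : ℕ → ℝ) (Q : Finset ℕ) (hx : ∀ p ∈ Q, 0 ≤ x p)
    (r : ℕ) : blockMean x Q (fun t => if t = r then 1 else 0) * r.factorial ≤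
      (∑ p ∈ Q, x p) ^ r := by
  classical
  induction Q using Finset.induction_on generalizing r with
  | empty => rcases r with _ | r <;> simp [blockMean]
  | insert p Q hp ih =>
    have hx' : ∀ q ∈ Q, 0 ≤ x q := fun q hq => hx q (Finset.mem_insert_of_mem hq)
    have hxp := hx p (Finset.mem_insert_self _ _)
    have hS : 0 ≤ ∑ q ∈ Q, x q := Finset.sum_nonneg hx'
    rw [blockMean_insert x hp, Finset.sum_insert hp]
    rcases r with _ | r
    · simp [blockMean]
    · simp only [Nat.add_right_cancel_iff]
      have h1 := ih hx' (r + 1)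
      have h2 := ih hx' r
      have h3 : (∑ q ∈ Q, x q) ^ (r + 1) + (r + 1) * (x p * (∑ q ∈ Q, x q) ^ r) ≤
          (x p + ∑ q ∈ Q, x q) ^ (r + 1) := by
        clear h1 h2 ih
        generalize (∑ q ∈ Q, x q) = S at *
        induction r with
        | zero => simp; linarith
        | succ r ih =>
          calc _ ≤ (x p + S) * (S ^ (r + 1) + (r + 1) * (x p * S ^ r)) := by
                have : 0 ≤ (r + 1) * x p ^ 2 * S ^ r := by positivity
                push_cast
                ring_nf at this ⊢
                linarith
            _ ≤ (x p + S) * (x p + S) ^ (r + 1) := by gcongr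
            _ = _ := by ring
      rw [Nat.factorial_succ] at h1 ⊢
      push_cast at h1 ⊢
      have h4 : ((r : ℝ) + 1) * x p * (blockMean x Q (fun t => if t = r then 1 else 0) *
          r.factorial) ≤ (r + 1) * x p * (∑ q ∈ Q, x q) ^ r := by gcongr
      nlinarith

theorem blockMean_bonferroniMulCoeff_le (x : ℕ → ℝ) (Q : Finset ℕ) (hx : ∀ p ∈ Q, 0 ≤ x p)
    (b : ℕ) : blockMean x Q (bonferroniMulCoeff b) ≤
      (∑ p ∈ Q, x p) ^ (2 * b + 1) / (2 * b).factorial := by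
  have h := blockMean_single_mul_factorial_le x Q hx (2 * b + 1)
  have h2 : blockMean x Q (bonferroniMulCoeff b) =
      (2 * b + 1) * blockMean x Q (fun t => if t = 2 * b + 1 then 1 else 0) := by
    rw [blockMean, blockMean, Finset.mul_sum]
    refine Finset.sum_congr rfl fun s _ => ?_
    simp only [bonferroniMulCoeff]
    split_ifs <;> ring
  rw [le_div_iff₀ (by positivity), h2]
  rw [Nat.factorial_succ] at h
  push_cast at h
  linarith

theorem blockError_le {N : ℕ} {Q : Finset ℕ} {g : ℕ → ℝ} {R : ℕ} {c : ℝ} (hc : 0 ≤ c)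
    (hg : ∀ r ≤ R, |g r| ≤ c) (hg' : ∀ r, R < r → g r = 0) :
    blockError N Q g ≤ c * (1 + Q.card * N) ^ R := by
  unfold blockError
  rw [Finset.sum_powerset_apply_card (fun r => |g r| * (N : ℝ) ^ r)]
  have h1 : ∑ r ∈ Finset.range (Q.card + 1), Q.card.choose r • (|g r| * (N : ℝ) ^ r) ≤
      ∑ r ∈ Finset.range (R + 1), Q.card.choose r • (|g r| * (N : ℝ) ^ r) := by
    rw [← Finset.sum_filter_of_ne (p := fun r => r ≤ R) fun r _ hr => ?_]
    · refine Finset.sum_le_sum_of_subset_of_nonneg (fun r hr => ?_) fun r _ _ => by positivity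
      rw [Finset.mem_filter] at hr
      exact Finset.mem_range.2 (by omega)
    · by_contra hlt
      exact hr (by rw [hg' r (by omega)]; simp)
  refine h1.trans ?_
  rw [add_comm (1 : ℝ), add_pow, Finset.mul_sum]
  refine Finset.sum_le_sum fun r hr => ?_
  rw [Finset.mem_range] at hr
  have h2 : (Q.card.choose r : ℝ) ≤ (Q.card : ℝ) ^ r := by exact_mod_cast Nat.choose_le_pow _ _
  have h3 : (1 : ℝ) ≤ R.choose r := by
    exact_mod_cast Nat.choose_pos (by omega)
  rw [nsmul_eq_mul, one_pow, mul_one]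
  calc (Q.card.choose r : ℝ) * (|g r| * (N : ℝ) ^ r) ≤ (Q.card : ℝ) ^ r * (c * (N : ℝ) ^ r) := by
        have := hg r (by omega)
        gcongr
    _ = c * ((Q.card * N : ℝ) ^ r * 1) := by rw [mul_pow]; ring
    _ ≤ _ := by gcongr

theorem blockError_bonferroniCoeff_le (N : ℕ) (Q : Finset ℕ) (b : ℕ) :
    blockError N Q (bonferroniCoeff b) ≤ (1 + Q.card * N) ^ (2 * b + 1) := by
  have := blockError_le (N := N) (Q := Q) (g := bonferroniCoeff b) (R := 2 * b + 1) zero_le_one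
    (fun r _ => by unfold bonferroniCoeff; split_ifs <;> simp)
    (fun r hr => by unfold bonferroniCoeff; rw [if_neg (by omega)])
  simpa using this

theorem blockError_bonferroniMulCoeff_le (N : ℕ) (Q : Finset ℕ) (b : ℕ) :
    blockError N Q (bonferroniMulCoeff b) ≤ (2 * b + 1) * (1 + Q.card * N) ^ (2 * b + 1) := by
  refine blockError_le (by positivity) (fun r _ => ?_) (fun r hr => ?_)
  · unfold bonferroniMulCoeff
    split_ifs
    · rw [abs_of_nonneg (by positivity)]
    · simp; positivity
  · unfold bonferroniMulCoeff
    rw [if_neg (by omega)]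

theorem sum_inv_primes_dyadic_le {k : ℕ} (hk : 0 < k) :
    ∑ p ∈ (Finset.Ioc (2 ^ k) (2 ^ (k + 1))).filter Nat.Prime, (1 / p : ℝ) ≤ 4 / k := by
  set S := (Finset.Ioc (2 ^ k) (2 ^ (k + 1))).filter Nat.Prime with hS
  have h1 : (2 ^ k) ^ S.card ≤ 4 ^ (2 ^ (k + 1)) := by
    calc (2 ^ k) ^ S.card ≤ ∏ p ∈ S, p := by
          refine Finset.pow_card_le_prod _ _ _ fun p hp => ?_
          simp only [hS, Finset.mem_filter, Finset.mem_Ioc] at hp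
          exact hp.1.1.le
      _ ≤ primorial (2 ^ (k + 1)) := by
          refine Finset.prod_le_prod_of_subset_of_one_le' (fun p hp => ?_) fun p hp _ => ?_
          · simp only [hS, Finset.mem_filter, Finset.mem_Ioc, Finset.mem_range] at hp ⊢
            exact ⟨by omega, hp.2⟩
          · exact (Finset.mem_filter.1 hp).2.one_lt.le
      _ ≤ _ := primorial_le_four_pow _
  have h2 : k * S.card ≤ 2 * 2 ^ (k + 1) := by
    rw [← pow_mul, show (4 : ℕ) = 2 ^ 2 by norm_num, ← pow_mul] at h1
    exact (Nat.pow_le_pow_iff_right (by norm_num)).1 h1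
  have h2' : (k : ℝ) * S.card ≤ 4 * 2 ^ k := by
    have : ((k * S.card : ℕ) : ℝ) ≤ ((2 * 2 ^ (k + 1) : ℕ) : ℝ) := by exact_mod_cast h2
    push_cast at this
    rw [pow_succ] at this
    linarith
  have hk' : (0 : ℝ) < k := by exact_mod_cast hk
  calc ∑ p ∈ S, (1 / p : ℝ) ≤ ∑ p ∈ S, (1 / 2 ^ k : ℝ) := by
        refine Finset.sum_le_sum fun p hp => ?_
        simp only [hS, Finset.mem_filter, Finset.mem_Ioc] at hp
        have : (2 : ℝ) ^ k ≤ p := by exact_mod_cast hp.1.1.le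
        gcongr
    _ = S.card / 2 ^ k := by rw [Finset.sum_const, nsmul_eq_mul]; ring
    _ ≤ 4 / k := by
        rw [div_le_div_iff₀ (by positivity) hk']
        linarith

/-- The primes in `(2 ^ 2 ^ j, 2 ^ 2 ^ (j + 1)]`. -/
def towerBlock (j : ℕ) : Finset ℕ := (Finset.Ioc (2 ^ 2 ^ j) (2 ^ 2 ^ (j + 1))).filter Nat.Prime

theorem mem_towerBlock {j p : ℕ} :
    p ∈ towerBlock j ↔ (2 ^ 2 ^ j < p ∧ p ≤ 2 ^ 2 ^ (j + 1)) ∧ p.Prime := by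
  simp [towerBlock]

theorem exists_mem_towerBlock {a b p : ℕ} (hp : p.Prime) (ha : 2 ^ 2 ^ a < p)
    (hb : p ≤ 2 ^ 2 ^ b) : ∃ j ∈ Finset.Ico a b, p ∈ towerBlock j := by
  induction b with
  | zero =>
    exact absurd (ha.trans_le hb) (by simp)
  | succ b ih =>
    by_cases h : p ≤ 2 ^ 2 ^ b
    · obtain ⟨j, hj, h⟩ := ih h
      rw [Finset.mem_Ico] at hj
      exact ⟨j, Finset.mem_Ico.2 ⟨hj.1, by omega⟩, h⟩
    · have hab : a < b + 1 := by
        have h1 := ha.trans_le hb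
        rwa [Nat.pow_lt_pow_iff_right (by norm_num), Nat.pow_lt_pow_iff_right (by norm_num)] at h1
      exact ⟨b, Finset.mem_Ico.2 ⟨by omega, by omega⟩, mem_towerBlock.2 ⟨⟨by omega, hb⟩, hp⟩⟩

theorem towerBlock_pairwiseDisjoint (s : Set ℕ) : s.PairwiseDisjoint towerBlock := by
  have key : ∀ i j, i < j → Disjoint (towerBlock i) (towerBlock j) := by
    intro i j hij
    rw [Finset.disjoint_left]
    intro p hi hj
    rw [mem_towerBlock] at hi hj
    have : 2 ^ 2 ^ (i + 1) ≤ 2 ^ 2 ^ j :=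
      Nat.pow_le_pow_right (by norm_num) (Nat.pow_le_pow_right (by norm_num) hij)
    omega
  intro i _ j _ hij
  rcases lt_or_gt_of_ne hij with h | h
  · exact key i j h
  · exact (key j i h).symm

theorem sum_inv_towerBlock_le (j : ℕ) : ∑ p ∈ towerBlock j, (1 / p : ℝ) ≤ 4 := by
  have key : ∀ m : ℕ, ∑ p ∈ (Finset.Ioc (2 ^ 2 ^ j) (2 ^ (2 ^ j + m))).filter Nat.Prime,
      (1 / p : ℝ) ≤ m * (4 / 2 ^ j) := by
    intro m
    induction m with
    | zero => simp
    | succ m ih =>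
      have hsplit : (Finset.Ioc (2 ^ 2 ^ j) (2 ^ (2 ^ j + (m + 1)))).filter Nat.Prime ⊆
          (Finset.Ioc (2 ^ 2 ^ j) (2 ^ (2 ^ j + m))).filter Nat.Prime ∪
          (Finset.Ioc (2 ^ (2 ^ j + m)) (2 ^ (2 ^ j + m + 1))).filter Nat.Prime := by
        intro p hp
        simp only [Finset.mem_union, Finset.mem_filter, Finset.mem_Ioc] at hp ⊢
        rw [← add_assoc] at hp
        by_cases h : p ≤ 2 ^ (2 ^ j + m)
        · exact Or.inl ⟨⟨hp.1.1, h⟩, hp.2⟩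
        · exact Or.inr ⟨⟨by omega, hp.1.2⟩, hp.2⟩
      have h1 := sum_inv_primes_dyadic_le (k := 2 ^ j + m) (by positivity)
      have h2 : (4 : ℝ) / ((2 ^ j + m : ℕ) : ℝ) ≤ 4 / 2 ^ j := by
        push_cast
        gcongr
        simp
      calc ∑ p ∈ (Finset.Ioc (2 ^ 2 ^ j) (2 ^ (2 ^ j + (m + 1)))).filter Nat.Prime, (1 / p : ℝ)
          ≤ _ := Finset.sum_le_sum_of_subset_of_nonneg hsplit fun _ _ _ => by positivity
        _ = _ := Finset.sum_union <| by
          rw [Finset.disjoint_left]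
          intro p hp hp'
          simp only [Finset.mem_filter, Finset.mem_Ioc] at hp hp'
          omega
        _ ≤ m * (4 / 2 ^ j) + 4 / 2 ^ j := add_le_add ih (h1.trans h2)
        _ = (m + 1 : ℕ) * (4 / 2 ^ j) := by push_cast; ring
  have := key (2 ^ j)
  rw [show 2 ^ j + 2 ^ j = 2 ^ (j + 1) by ring] at this
  refine this.trans_eq ?_
  push_cast
  field_simp

theorem one_add_card_towerBlock_mul_le {N j : ℕ} (hN : N ≤ 2 ^ 2 ^ j) :
    (1 + (towerBlock j).card * N : ℝ) ≤ 2 ^ 2 ^ (j + 2) := by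
  have h1 : (towerBlock j).card ≤ 2 ^ 2 ^ (j + 1) - 2 ^ 2 ^ j := by
    refine (Finset.card_filter_le _ _).trans ?_
    simp
  have h2 : 2 ^ 2 ^ j ≤ 2 ^ 2 ^ (j + 1) :=
    Nat.pow_le_pow_right (by norm_num) (Nat.pow_le_pow_right (by norm_num) (by omega))
  have h3 : 2 ^ 2 ^ (j + 2) = 2 ^ 2 ^ (j + 1) * 2 ^ 2 ^ (j + 1) := by
    rw [← pow_add]; congr 1; ring
  have h0 : 0 < 2 ^ 2 ^ j := by positivity
  have : 1 + (towerBlock j).card * N ≤ 2 ^ 2 ^ (j + 2) := by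
    rw [h3]
    have h4 : (towerBlock j).card * N ≤ (2 ^ 2 ^ (j + 1) - 1) * 2 ^ 2 ^ (j + 1) :=
      Nat.mul_le_mul (by omega) (by omega)
    rw [Nat.sub_mul] at h4
    have : 1 * 2 ^ 2 ^ (j + 1) ≤ 2 ^ 2 ^ (j + 1) * 2 ^ 2 ^ (j + 1) :=
      Nat.mul_le_mul (by omega) le_rfl
    omega
  exact_mod_cast this

theorem fourth_rpow_le_one_sub {x : ℝ} (h0 : 0 ≤ x) (h1 : x ≤ 1 / 2) :
    (1 / 4 : ℝ) ^ x ≤ 1 - x := by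
  have h := _root_.rpow_one_add_le_one_add_mul_self (s := -(1 / 2)) (p := 2 * x) (by norm_num)
    (by linarith) (by linarith)
  rw [Real.rpow_mul (by norm_num)] at h
  norm_num at h ⊢
  linarith

theorem pow_div_factorial_mul_le {N : ℕ} (hN : 4 ≤ N) (i : ℕ) :
    (4 * N : ℝ) ^ (2 * (13 * N + i) + 1) / (2 * (13 * N + i)).factorial ≤
      (1 / 2) ^ (i + 3) * (1 / 4) ^ (4 * N) := by
  have hN' : (4 : ℝ) ≤ N := by exact_mod_cast hN
  have h1 : ((8 * N).factorial : ℝ) * (8 * N) ^ (18 * N + 2 * i) ≤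
      (2 * (13 * N + i)).factorial := by
    have h := @Nat.factorial_mul_pow_le_factorial (8 * N) (18 * N + 2 * i)
    rw [show 8 * N + (18 * N + 2 * i) = 2 * (13 * N + i) by ring] at h
    calc _ ≤ ((8 * N).factorial : ℝ) * ((8 * N + 1 : ℕ) : ℝ) ^ (18 * N + 2 * i) := by
          gcongr
          push_cast
          linarith
      _ ≤ _ := by exact_mod_cast h
  have h2 : (4 * N : ℝ) ^ (8 * N) ≤ 2 ^ (8 * N) * (8 * N).factorial := by
    have h := Real.pow_div_factorial_le_exp (x := 4 * N) (by positivity) (8 * N)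
    rw [div_le_iff₀ (by positivity)] at h
    refine h.trans ?_
    gcongr
    calc Real.exp (4 * N) = Real.exp 1 ^ (4 * N) := by rw [← Real.exp_nat_mul]; push_cast; ring_nf
      _ ≤ 4 ^ (4 * N) := by
          gcongr
          linarith [Real.exp_one_lt_d9]
      _ = 2 ^ (8 * N) := by
          rw [show (4 : ℝ) = 2 ^ 2 by norm_num, ← pow_mul]; ring_nf
  have h3 : (32 * N : ℝ) ≤ 2 ^ (2 * N) := by
    have : ∀ m : ℕ, 4 ≤ m → 32 * m ≤ 2 ^ (2 * m) := by
      intro m hm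
      induction m, hm using Nat.le_induction with
      | base => norm_num
      | succ m hm ih => rw [mul_add 2, pow_add]; omega
    exact_mod_cast this N hN
  rw [div_le_iff₀ (by positivity)]
  calc (4 * N : ℝ) ^ (2 * (13 * N + i) + 1)
      = (4 * N) * ((4 * N) ^ (8 * N) * (4 * N) ^ (18 * N + 2 * i)) := by
        rw [← pow_add, ← pow_succ']; congr 1; ring
    _ ≤ (2 ^ (2 * N) / 8) * ((2 ^ (8 * N) * (8 * N).factorial) * (4 * N) ^ (18 * N + 2 * i)) := by
        gcongr
        linarith
    _ = (1 / 2) ^ (3 + 2 * i) * (1 / 4) ^ (4 * N) *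
        ((8 * N).factorial * (8 * N) ^ (18 * N + 2 * i)) := by
        rw [show (8 * N : ℝ) = 2 * (4 * N) by ring, mul_pow 2 (4 * N : ℝ),
          show (1 / 4 : ℝ) = (1 / 2) ^ 2 by norm_num, ← pow_mul, one_div, inv_pow, inv_pow]
        field_simp
        ring
    _ ≤ (1 / 2) ^ (i + 3) * (1 / 4) ^ (4 * N) * (2 * (13 * N + i)).factorial := by
        have : (1 / 2 : ℝ) ^ (3 + 2 * i) ≤ (1 / 2) ^ (i + 3) :=
          pow_le_pow_of_le_one (by norm_num) (by norm_num) (by omega)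
        gcongr

theorem div_le_half_of_mem_towerBlock {N j p : ℕ} (hN : 2 * N ≤ 2 ^ 2 ^ j)
    (hp : p ∈ towerBlock j) : (N / p : ℝ) ≤ 1 / 2 := by
  rw [mem_towerBlock] at hp
  have : 2 * N ≤ p := by omega
  have : (2 * N : ℝ) ≤ p := by exact_mod_cast this
  have : (0 : ℝ) < p := by exact_mod_cast hp.2.pos
  rw [div_le_iff₀ this]
  linarith

theorem sum_div_towerBlock_le (N j : ℕ) : ∑ p ∈ towerBlock j, (N / p : ℝ) ≤ 4 * N := by
  calc ∑ p ∈ towerBlock j, (N / p : ℝ) = N * ∑ p ∈ towerBlock j, (1 / p : ℝ) := by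
        rw [Finset.mul_sum]
        exact Finset.sum_congr rfl fun p _ => by ring
    _ ≤ N * 4 := by
        gcongr
        exact sum_inv_towerBlock_le j
    _ = 4 * N := by ring

theorem pow_le_blockMean_towerBlock {N j : ℕ} (hN : 2 * N ≤ 2 ^ 2 ^ j) (b : ℕ) :
    (1 / 4 : ℝ) ^ (4 * N) ≤ blockMean (fun p => N / p) (towerBlock j) (bonferroniCoeff b) := by
  have hx : ∀ p ∈ towerBlock j, (N / p : ℝ) ≤ 1 / 2 := fun p hp =>
    div_le_half_of_mem_towerBlock hN hp
  refine le_trans ?_ (prod_one_sub_le_blockMean_bonferroniCoeff (fun p => N / p) (towerBlock j)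
    (fun p _ => by positivity) (fun p hp => (hx p hp).trans (by norm_num)) b)
  calc (1 / 4 : ℝ) ^ (4 * N) = (1 / 4 : ℝ) ^ (4 * N : ℝ) := by
        rw [← Real.rpow_natCast]; push_cast; rfl
    _ ≤ (1 / 4 : ℝ) ^ (∑ p ∈ towerBlock j, (N / p : ℝ)) :=
        Real.rpow_le_rpow_of_exponent_ge (by norm_num) (by norm_num) (sum_div_towerBlock_le N j)
    _ = ∏ p ∈ towerBlock j, (1 / 4 : ℝ) ^ (N / p : ℝ) :=
        Real.rpow_sum_of_pos (by norm_num) _ _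
    _ ≤ _ := Finset.prod_le_prod (fun p _ => by positivity) fun p hp =>
        fourth_rpow_le_one_sub (by positivity) (hx p hp)

theorem blockMean_towerBlock_bonferroniMulCoeff_le {N j : ℕ} (hN4 : 4 ≤ N)
    (hN : 2 * N ≤ 2 ^ 2 ^ j) (i : ℕ) :
    blockMean (fun p => N / p) (towerBlock j) (bonferroniMulCoeff (13 * N + i)) ≤
      (1 / 2) ^ (i + 3) *
        blockMean (fun p => N / p) (towerBlock j) (bonferroniCoeff (13 * N + i)) := by
  have h1 := blockMean_bonferroniMulCoeff_le (fun p => N / p) (towerBlock j)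
    (fun p _ => by positivity) (13 * N + i)
  have h2 := pow_le_blockMean_towerBlock hN (13 * N + i)
  refine h1.trans ?_
  calc _ ≤ (4 * N : ℝ) ^ (2 * (13 * N + i) + 1) / (2 * (13 * N + i)).factorial := by
        gcongr
        exact sum_div_towerBlock_le N j
    _ ≤ (1 / 2) ^ (i + 3) * (1 / 4) ^ (4 * N) := pow_div_factorial_mul_le hN4 i
    _ ≤ _ := by gcongr

theorem HasClassMean.mono_error {X : ℕ} {S : Finset ℕ} {F : ℕ → ℝ} {m E E' : ℝ}
    (h : HasClassMean X S F m E) (hE : E ≤ E') : HasClassMean X S F m E' :=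
  fun q c hq hS => (h q c hq hS).trans hE

theorem HasClassMean.abs_sum_range_sub_le {X : ℕ} {S : Finset ℕ} {F : ℕ → ℝ} {m E : ℝ}
    (h : HasClassMean X S F m E) : |∑ n ∈ Finset.range X, F n - X * m| ≤ E := by
  have := h 1 0 one_pos fun p _ => Nat.coprime_one_right p
  simpa [Nat.modEq_one] using this

theorem sum_Ico_two_pow_mul_le (a J c : ℕ) :
    ∑ j ∈ Finset.Ico a J, 2 ^ (j + 2) * (c + 2 * (J - 1 - j)) ≤ 4 * 2 ^ J * (c + 2) := by
  induction J generalizing c with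
  | zero => simp
  | succ J ih =>
    rcases lt_or_ge J a with h | h
    · rw [Finset.Ico_eq_empty (by omega)]
      simp
    · rw [Finset.sum_Ico_succ_top h]
      have h1 : ∑ j ∈ Finset.Ico a J, 2 ^ (j + 2) * (c + 2 * (J + 1 - 1 - j)) =
          ∑ j ∈ Finset.Ico a J, 2 ^ (j + 2) * ((c + 2) + 2 * (J - 1 - j)) := by
        refine Finset.sum_congr rfl fun j hj => ?_
        rw [Finset.mem_Ico] at hj
        congr 1
        omega
      rw [h1]
      have h2 := ih (c + 2)
      have h3 : J + 1 - 1 - J = 0 := by omega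
      rw [h3, pow_add 2 J 2, pow_succ 2 J]
      nlinarith

/-- The depth of the truncated inclusion-exclusion on `towerBlock j` when the blocks below `J` are
sieved. -/
def sieveDepth (N J j : ℕ) : ℕ := 13 * N + (J - 1 - j)

/-- A nonnegative upper bound for the indicator function of the `n` not hit by any prime in
the blocks `towerBlock j`, `a ≤ j < J`. -/
noncomputable def towerWeight (hit : ℕ → ℕ → Prop) (N a J n : ℕ) : ℝ :=
  ∏ j ∈ Finset.Ico a J, blockWeight hit (towerBlock j) (bonferroniCoeff (sieveDepth N J j)) n

/-- The mean value of `towerWeight`. -/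
noncomputable def towerMean (N a J : ℕ) : ℝ :=
  ∏ j ∈ Finset.Ico a J,
    blockMean (fun p => N / p) (towerBlock j) (bonferroniCoeff (sieveDepth N J j))

theorem towerWeight_nonneg (hit : ℕ → ℕ → Prop) (N a J n : ℕ) : 0 ≤ towerWeight hit N a J n :=
  Finset.prod_nonneg fun _ _ => blockWeight_bonferroniCoeff_nonneg _ _ _ _

theorem towerWeight_eq_one {hit : ℕ → ℕ → Prop} (N : ℕ) {a J n : ℕ}
    (h : ∀ j ∈ Finset.Ico a J, hitCount hit (towerBlock j) n = 0) :
    towerWeight hit N a J n = 1 :=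
  Finset.prod_eq_one fun j hj => blockWeight_bonferroniCoeff_eq_one _ (h j hj)

theorem two_mul_le_of_le {N a j : ℕ} (hN : 2 * N ≤ 2 ^ 2 ^ a) (h : a ≤ j) :
    2 * N ≤ 2 ^ 2 ^ j :=
  hN.trans (Nat.pow_le_pow_right two_pos (Nat.pow_le_pow_right two_pos h))

theorem pow_le_towerMean {N a : ℕ} (hN : 2 * N ≤ 2 ^ 2 ^ a) (J : ℕ) :
    (1 / 4 : ℝ) ^ (4 * N * J) ≤ towerMean N a J := by
  calc (1 / 4 : ℝ) ^ (4 * N * J) ≤ (1 / 4 : ℝ) ^ (4 * N * (J - a)) :=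
        pow_le_pow_of_le_one (by norm_num) (by norm_num) (Nat.mul_le_mul_left _ (Nat.sub_le _ _))
    _ = ∏ j ∈ Finset.Ico a J, (1 / 4 : ℝ) ^ (4 * N) := by
        rw [Finset.prod_const, Nat.card_Ico, pow_mul]
    _ ≤ towerMean N a J := Finset.prod_le_prod (fun _ _ => by positivity) fun j hj =>
        pow_le_blockMean_towerBlock (two_mul_le_of_le hN (Finset.mem_Ico.1 hj).1) _

theorem towerMean_pos {N a : ℕ} (hN : 2 * N ≤ 2 ^ 2 ^ a) (J : ℕ) : 0 < towerMean N a J :=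
  lt_of_lt_of_le (by positivity) (pow_le_towerMean hN J)

theorem blockError_nonneg (N : ℕ) (Q : Finset ℕ) (g : ℕ → ℝ) : 0 ≤ blockError N Q g :=
  Finset.sum_nonneg fun _ _ => by positivity

theorem prod_two_pow_le (N a J : ℕ) :
    ∏ j ∈ Finset.Ico a J, ((2 : ℝ) ^ 2 ^ (j + 2)) ^ (2 * sieveDepth N J j + 1) ≤
      (2 ^ 2 ^ J) ^ (104 * N + 12) := by
  simp only [← pow_mul]
  rw [Finset.prod_pow_eq_pow_sum]
  refine pow_le_pow_right₀ one_le_two ?_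
  have h := sum_Ico_two_pow_mul_le a J (26 * N + 1)
  have h1 : ∑ j ∈ Finset.Ico a J, 2 ^ (j + 2) * (2 * sieveDepth N J j + 1) =
      ∑ j ∈ Finset.Ico a J, 2 ^ (j + 2) * (26 * N + 1 + 2 * (J - 1 - j)) :=
    Finset.sum_congr rfl fun j _ => by unfold sieveDepth; ring
  rw [h1]
  refine h.trans (le_of_eq (by ring))

theorem one_add_card_towerBlock_pow_le {N j : ℕ} (hN : 2 * N ≤ 2 ^ 2 ^ j) (r : ℕ) :
    (1 + (towerBlock j).card * N : ℝ) ^ r ≤ (2 ^ 2 ^ (j + 2)) ^ r := by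
  gcongr
  exact one_add_card_towerBlock_mul_le (by omega)

section Sieve

variable {hit : ℕ → ℕ → Prop} {N a J : ℕ}

theorem hasClassMean_towerWeight (hN : 2 * N ≤ 2 ^ 2 ^ a)
    (hit_roots : ∀ p : ℕ, p.Prime → 2 ^ 2 ^ a < p → HasRoots N hit p) (X : ℕ) :
    HasClassMean X ((Finset.Ico a J).biUnion towerBlock) (towerWeight hit N a J)
      (towerMean N a J) ((2 ^ 2 ^ J) ^ (104 * N + 12)) := by
  refine (HasClassMean.prod_blockWeight (N := N) (hit := hit) (Finset.Ico a J) towerBlock ?_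
    (towerBlock_pairwiseDisjoint _) _).mono_error ?_
  · intro j hj p hp
    rw [mem_towerBlock] at hp
    refine hit_roots p hp.2 (lt_of_le_of_lt ?_ hp.1.1)
    exact Nat.pow_le_pow_right two_pos (Nat.pow_le_pow_right two_pos (Finset.mem_Ico.1 hj).1)
  · refine le_trans ?_ (prod_two_pow_le N a J)
    refine Finset.prod_le_prod (fun _ _ => blockError_nonneg _ _ _) fun j hj => ?_
    exact (blockError_bonferroniCoeff_le _ _ _).trans
      (one_add_card_towerBlock_pow_le (two_mul_le_of_le hN (Finset.mem_Ico.1 hj).1) _)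

theorem sum_towerWeight_mul_hitCount_le (hN4 : 4 ≤ N) (hN : 2 * N ≤ 2 ^ 2 ^ a)
    (hit_roots : ∀ p : ℕ, p.Prime → 2 ^ 2 ^ a < p → HasRoots N hit p) (X : ℕ) {j : ℕ}
    (hj : j ∈ Finset.Ico a J) :
    ∑ n ∈ Finset.range X, towerWeight hit N a J n * hitCount hit (towerBlock j) n ≤
      X * towerMean N a J * (1 / 2) ^ (J - 1 - j + 3) +
        (26 * N + 2 * J + 1) * (2 ^ 2 ^ J) ^ (104 * N + 12) := by
  have hroots : ∀ i ∈ Finset.Ico a J, ∀ p ∈ towerBlock i, HasRoots N hit p := by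
    intro i hi p hp
    rw [mem_towerBlock] at hp
    refine hit_roots p hp.2 (lt_of_le_of_lt ?_ hp.1.1)
    exact Nat.pow_le_pow_right two_pos (Nat.pow_le_pow_right two_pos (Finset.mem_Ico.1 hi).1)
  have hNi : ∀ i ∈ Finset.Ico a J, 2 * N ≤ 2 ^ 2 ^ i := fun i hi =>
    two_mul_le_of_le hN (Finset.mem_Ico.1 hi).1
  set g : ℕ → ℕ → ℝ := fun i => if i = j then bonferroniMulCoeff (sieveDepth N J i)
    else bonferroniCoeff (sieveDepth N J i) with hg
  have hgj : g j = bonferroniMulCoeff (sieveDepth N J j) := if_pos rfl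
  have hgi : ∀ i ∈ (Finset.Ico a J).erase j, g i = bonferroniCoeff (sieveDepth N J i) :=
    fun i hi => if_neg (Finset.ne_of_mem_erase hi)
  have h := (HasClassMean.prod_blockWeight (X := X) (Finset.Ico a J) towerBlock hroots
    (towerBlock_pairwiseDisjoint _) g).abs_sum_range_sub_le
  have hw : ∀ n, ∏ i ∈ Finset.Ico a J, blockWeight hit (towerBlock i) (g i) n =
      towerWeight hit N a J n * hitCount hit (towerBlock j) n := by
    intro n
    rw [towerWeight, ← Finset.mul_prod_erase _ _ hj, ← Finset.mul_prod_erase _ _ hj, hgj,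
      blockWeight_bonferroniMulCoeff,
      Finset.prod_congr rfl fun i hi => by rw [hgi i hi]]
    ring
  have hm : ∏ i ∈ Finset.Ico a J, blockMean (fun p => (N / p : ℝ)) (towerBlock i) (g i) ≤
      towerMean N a J * (1 / 2) ^ (J - 1 - j + 3) := by
    rw [towerMean, ← Finset.mul_prod_erase _ _ hj, ← Finset.mul_prod_erase _ _ hj, hgj,
      Finset.prod_congr rfl fun i hi => by rw [hgi i hi]]
    have h0 : 0 ≤ ∏ i ∈ (Finset.Ico a J).erase j, blockMean (fun p => (N / p : ℝ)) (towerBlock i)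
        (bonferroniCoeff (sieveDepth N J i)) := Finset.prod_nonneg fun i hi =>
      le_trans (by positivity) (pow_le_blockMean_towerBlock (hNi i (Finset.mem_of_mem_erase hi)) _)
    have h1 := blockMean_towerBlock_bonferroniMulCoeff_le hN4 (hNi j hj) (J - 1 - j)
    calc _ ≤ (1 / 2 : ℝ) ^ (J - 1 - j + 3) * blockMean (fun p => (N / p : ℝ)) (towerBlock j)
          (bonferroniCoeff (sieveDepth N J j)) * _ := mul_le_mul_of_nonneg_right h1 h0
      _ = _ := by ring
  have he : ∏ i ∈ Finset.Ico a J, blockError N (towerBlock i) (g i) ≤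
      (26 * N + 2 * J + 1) * (2 ^ 2 ^ J) ^ (104 * N + 12) := by
    calc ∏ i ∈ Finset.Ico a J, blockError N (towerBlock i) (g i)
        ≤ ∏ i ∈ Finset.Ico a J, (if i = j then (26 * N + 2 * J + 1 : ℝ) else 1) *
          (2 ^ 2 ^ (i + 2)) ^ (2 * sieveDepth N J i + 1) := by
          refine Finset.prod_le_prod (fun _ _ => blockError_nonneg _ _ _) fun i hi => ?_
          have hpow := one_add_card_towerBlock_pow_le (hNi i hi) (2 * sieveDepth N J i + 1)
          by_cases hij : i = j
          · rw [hg]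
            simp only [if_pos hij]
            refine (blockError_bonferroniMulCoeff_le _ _ _).trans ?_
            gcongr
            have : 2 * sieveDepth N J i ≤ 26 * N + 2 * J := by
              unfold sieveDepth
              omega
            exact_mod_cast this
          · rw [hg]
            simp only [if_neg hij, one_mul]
            exact (blockError_bonferroniCoeff_le _ _ _).trans hpow
      _ = (26 * N + 2 * J + 1 : ℝ) *
          ∏ i ∈ Finset.Ico a J, ((2 : ℝ) ^ 2 ^ (i + 2)) ^ (2 * sieveDepth N J i + 1) := by
          rw [Finset.prod_mul_distrib, Finset.prod_ite_eq', if_pos hj]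
      _ ≤ _ := by
          gcongr
          exact prod_two_pow_le N a J
  simp only [hw] at h
  have h2 := (abs_le.1 h).2
  have h3 := mul_le_mul_of_nonneg_left hm (Nat.cast_nonneg (α := ℝ) X)
  linarith

open Classical in
theorem sum_towerWeight_mul_hit_le (hN : 2 * N ≤ 2 ^ 2 ^ a) (haJ : a ≤ J)
    (hit_roots : ∀ p : ℕ, p.Prime → 2 ^ 2 ^ a < p → HasRoots N hit p) (X : ℕ) {p : ℕ}
    (hp : p.Prime) (hpJ : 2 ^ 2 ^ J < p) :
    ∑ n ∈ Finset.range X, towerWeight hit N a J n * (if hit p n then 1 else 0) ≤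
      X * towerMean N a J * (N / p) + N * (2 ^ 2 ^ J) ^ (104 * N + 12) := by
  obtain ⟨-, r, hr, hr'⟩ := hit_roots p hp (lt_of_le_of_lt
    (Nat.pow_le_pow_right two_pos (Nat.pow_le_pow_right two_pos haJ)) hpJ)
  have h := ((hasClassMean_towerWeight hN hit_roots X (J := J)).mul_indicator hp ?_
    hr hr').abs_sum_range_sub_le
  · have := (abs_le.1 h).2
    linarith
  · intro q hq
    obtain ⟨j, hj, hq⟩ := Finset.mem_biUnion.1 hq
    rw [mem_towerBlock] at hq
    rw [Finset.mem_Ico] at hj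
    refine (Nat.coprime_primes hq.2 hp).2 ?_
    have : 2 ^ 2 ^ (j + 1) ≤ 2 ^ 2 ^ J :=
      Nat.pow_le_pow_right two_pos (Nat.pow_le_pow_right two_pos hj.2)
    omega

theorem sum_towerWeight_mul_hitCount_le_of_le (hN : 2 * N ≤ 2 ^ 2 ^ a) (haJ : a ≤ J)
    (hit_roots : ∀ p : ℕ, p.Prime → 2 ^ 2 ^ a < p → HasRoots N hit p) (X : ℕ) {j : ℕ}
    (hj : J ≤ j) :
    ∑ n ∈ Finset.range X, towerWeight hit N a J n * hitCount hit (towerBlock j) n ≤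
      X * towerMean N a J * (4 * N) +
        2 ^ 2 ^ (j + 1) * (N * (2 ^ 2 ^ J) ^ (104 * N + 12)) := by
  classical
  have hcard : ((towerBlock j).card : ℝ) ≤ 2 ^ 2 ^ (j + 1) := by
    have : (towerBlock j).card ≤ 2 ^ 2 ^ (j + 1) := by
      refine (Finset.card_filter_le _ _).trans ?_
      simp
    exact_mod_cast this
  have hM : 0 ≤ X * towerMean N a J := mul_nonneg (Nat.cast_nonneg _) (towerMean_pos hN J).le
  calc ∑ n ∈ Finset.range X, towerWeight hit N a J n * hitCount hit (towerBlock j) n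
      = ∑ p ∈ towerBlock j, ∑ n ∈ Finset.range X,
          towerWeight hit N a J n * (if hit p n then 1 else 0) := by
        rw [Finset.sum_comm]
        refine Finset.sum_congr rfl fun n _ => ?_
        rw [← Finset.mul_sum, hitCount, Finset.sum_boole]
    _ ≤ ∑ p ∈ towerBlock j, (X * towerMean N a J * (N / p) +
          N * (2 ^ 2 ^ J) ^ (104 * N + 12)) := by
        refine Finset.sum_le_sum fun p hp => ?_
        rw [mem_towerBlock] at hp
        refine sum_towerWeight_mul_hit_le hN haJ hit_roots X hp.2 (lt_of_le_of_lt ?_ hp.1.1)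
        exact Nat.pow_le_pow_right two_pos (Nat.pow_le_pow_right two_pos hj)
    _ = X * towerMean N a J * ∑ p ∈ towerBlock j, (N / p : ℝ) +
          (towerBlock j).card * (N * (2 ^ 2 ^ J) ^ (104 * N + 12)) := by
        rw [Finset.sum_add_distrib, ← Finset.mul_sum, Finset.sum_const, nsmul_eq_mul]
    _ ≤ _ := by
        gcongr
        exact sum_div_towerBlock_le N j

end Sieve

theorem sum_half_pow_le (a J : ℕ) :
    ∑ j ∈ Finset.Ico a J, (1 / 2 : ℝ) ^ (J - 1 - j + 3) ≤ 1 / 4 := by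
  calc ∑ j ∈ Finset.Ico a J, (1 / 2 : ℝ) ^ (J - 1 - j + 3)
      ≤ ∑ j ∈ Finset.range J, (1 / 2 : ℝ) ^ (J - 1 - j + 3) :=
        Finset.sum_le_sum_of_subset_of_nonneg
          (fun j hj => Finset.mem_range.2 (Finset.mem_Ico.1 hj).2) fun _ _ _ => by positivity
    _ = ∑ j ∈ Finset.range J, (1 / 2 : ℝ) ^ (j + 3) :=
        Finset.sum_range_reflect (fun j => (1 / 2 : ℝ) ^ (j + 3)) J
    _ = (∑ j ∈ Finset.range J, (1 / 2 : ℝ) ^ j) * (1 / 8) := by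
        rw [Finset.sum_mul]
        exact Finset.sum_congr rfl fun j _ => by rw [pow_add]; norm_num
    _ ≤ 2 * (1 / 8) := by
        gcongr
        exact sum_geometric_two_le J
    _ = 1 / 4 := by norm_num

theorem const_mul_four_pow_lt {N J : ℕ} (hN : N ≤ J) (hJ : 10 ≤ J) :
    2 * (2 + 2 * N + J * (26 * N + 2 * J + 1)) * 4 ^ (4 * N * J) < 2 ^ 2 ^ J := by
  have h1 : ∀ m : ℕ, 10 ≤ m → 8 * m ^ 2 + 2 * m + 7 < 2 ^ m := by
    intro m hm
    induction m, hm using Nat.le_induction with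
    | base => norm_num
    | succ m hm ih => rw [pow_succ 2 m]; nlinarith
  have h2 : 2 * (2 + 2 * N + J * (26 * N + 2 * J + 1)) ≤ 2 ^ (2 * J + 7) := by
    have h3 : J < 2 ^ J := Nat.lt_two_pow_self
    have h4 : J * J ≤ 2 ^ J * 2 ^ J := Nat.mul_le_mul h3.le h3.le
    have h5 : J * N ≤ J * J := Nat.mul_le_mul_left _ hN
    rw [pow_add, two_mul J, pow_add]
    nlinarith
  calc 2 * (2 + 2 * N + J * (26 * N + 2 * J + 1)) * 4 ^ (4 * N * J)
      ≤ 2 ^ (2 * J + 7) * 4 ^ (4 * J * J) := by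
        gcongr
        norm_num
    _ = 2 ^ (8 * J ^ 2 + 2 * J + 7) := by
        rw [show 4 = 2 ^ 2 by norm_num, ← pow_mul, ← pow_add]
        congr 1
        ring
    _ < 2 ^ 2 ^ J := Nat.pow_lt_pow_right (by norm_num) (h1 J hJ)

theorem exists_sifted {hit : ℕ → ℕ → Prop} {N a J s : ℕ} (hN4 : 4 ≤ N)
    (hN : 2 * N ≤ 2 ^ 2 ^ a) (haJ : a ≤ J) (hs : 2 * (104 * N + 13) ≤ 2 ^ s)
    (hNJ : N ≤ J) (hJ : 10 ≤ J)
    (hit_roots : ∀ p : ℕ, p.Prime → 2 ^ 2 ^ a < p → HasRoots N hit p) (bad : ℕ → Prop)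
    [DecidablePred bad]
    (hbad : ((Finset.range (2 ^ 2 ^ (J + s))).filter bad).card * 2 ^ 2 ^ J ≤
      2 * N * 2 ^ 2 ^ (J + s)) :
    ∃ n < 2 ^ 2 ^ (J + s), (∀ j ∈ Finset.Ico a J, hitCount hit (towerBlock j) n = 0) ∧ ¬ bad n ∧
      ∑ j ∈ Finset.Ico J (J + (s - 1)), hitCount hit (towerBlock j) n < 16 * N * s := by
  classical
  by_contra! hcon
  have hs0 : 1 ≤ s := by
    by_contra! h
    interval_cases s
    omega
  set U : ℝ := 2 ^ 2 ^ J with hU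
  set X : ℕ := 2 ^ 2 ^ (J + s) with hX
  set M : ℝ := towerMean N a J with hM
  have hU1 : 1 ≤ U := one_le_pow₀ one_le_two
  set R : ℝ := U ^ (2 ^ s - 1) with hR
  have hR0 : 0 < R := by positivity
  have hXU : (X : ℝ) = R * U := by
    rw [hR, ← pow_succ, Nat.sub_add_cancel Nat.one_le_two_pow, hU, ← pow_mul, ← pow_add, hX]
    push_cast
    rfl
  have hM0 : 0 < M := towerMean_pos hN J
  have hT : (0 : ℝ) < 16 * N * s := by
    have : (0 : ℝ) < N := by exact_mod_cast (by omega : 0 < N)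
    have : (0 : ℝ) < s := by exact_mod_cast hs0
    positivity
  set w : ℕ → ℝ := towerWeight hit N a J with hw
  have hw0 : ∀ n, 0 ≤ w n := towerWeight_nonneg hit N a J
  have hpoint : ∀ n ∈ Finset.range X, w n ≤
      ∑ j ∈ Finset.Ico a J, w n * hitCount hit (towerBlock j) n + (if bad n then 1 else 0) +
        (∑ j ∈ Finset.Ico J (J + (s - 1)), w n * hitCount hit (towerBlock j) n) /
          (16 * N * s) := by
    intro n hn
    have hn' := Finset.mem_range.1 hn
    have p1 : ∀ I : Finset ℕ, 0 ≤ ∑ j ∈ I, w n * (hitCount hit (towerBlock j) n : ℝ) := fun I =>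
      Finset.sum_nonneg fun j _ => mul_nonneg (hw0 n) (Nat.cast_nonneg _)
    have p2 : (0 : ℝ) ≤ if bad n then 1 else 0 := by split_ifs <;> norm_num
    have p3 := div_nonneg (p1 (Finset.Ico J (J + (s - 1)))) hT.le
    by_cases h1 : ∀ j ∈ Finset.Ico a J, hitCount hit (towerBlock j) n = 0
    · by_cases h2 : bad n
      · rw [if_pos h2] at p2 ⊢
        have : w n = 1 := towerWeight_eq_one N h1
        have := p1 (Finset.Ico a J)
        linarith
      · have h3 := hcon n hn' h1 h2
        have h3' : (16 * N * s : ℝ) ≤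
            ∑ j ∈ Finset.Ico J (J + (s - 1)), (hitCount hit (towerBlock j) n : ℝ) := by
          exact_mod_cast h3
        have : w n ≤ (∑ j ∈ Finset.Ico J (J + (s - 1)), w n * hitCount hit (towerBlock j) n) /
            (16 * N * s) := by
          rw [le_div_iff₀ hT, ← Finset.mul_sum]
          exact mul_le_mul_of_nonneg_left h3' (hw0 n)
        have := p1 (Finset.Ico a J)
        linarith
    · push Not at h1
      obtain ⟨j, hj, hj0⟩ := h1
      have : w n * hitCount hit (towerBlock j) n ≤
          ∑ j ∈ Finset.Ico a J, w n * (hitCount hit (towerBlock j) n : ℝ) :=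
        Finset.single_le_sum (f := fun j => w n * (hitCount hit (towerBlock j) n : ℝ))
          (fun j _ => mul_nonneg (hw0 n) (Nat.cast_nonneg _)) hj
      have h4 : (1 : ℝ) ≤ hitCount hit (towerBlock j) n := by
        exact_mod_cast Nat.one_le_iff_ne_zero.2 hj0
      have := le_mul_of_one_le_right (hw0 n) h4
      linarith
  have hsum := Finset.sum_le_sum hpoint
  rw [Finset.sum_add_distrib, Finset.sum_add_distrib, ← Finset.sum_div, Finset.sum_comm,
    Finset.sum_comm (s := Finset.range X) (t := Finset.Ico J (J + (s - 1))),
    Finset.sum_boole] at hsum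
  have hE : U ^ (104 * N + 12) ≤ R := pow_le_pow_right₀ hU1 (by omega)
  have hs2 : 2 ^ s = 2 * 2 ^ (s - 1) := by
    rw [← pow_succ', Nat.sub_add_cancel hs0]
  have hlow := (abs_le.1 (hasClassMean_towerWeight hN hit_roots X (J := J)).abs_sum_range_sub_le).1
  have hA : ∑ j ∈ Finset.Ico a J, ∑ n ∈ Finset.range X, w n * (hitCount hit (towerBlock j) n : ℝ) ≤
      X * M / 4 + J * (26 * N + 2 * J + 1) * R := by
    calc _ ≤ ∑ j ∈ Finset.Ico a J, (X * M * (1 / 2) ^ (J - 1 - j + 3) +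
          (26 * N + 2 * J + 1) * U ^ (104 * N + 12)) :=
          Finset.sum_le_sum fun j hj => sum_towerWeight_mul_hitCount_le hN4 hN hit_roots X hj
      _ = X * M * ∑ j ∈ Finset.Ico a J, (1 / 2 : ℝ) ^ (J - 1 - j + 3) +
          (J - a : ℕ) * ((26 * N + 2 * J + 1) * U ^ (104 * N + 12)) := by
          rw [Finset.sum_add_distrib, ← Finset.mul_sum, Finset.sum_const, nsmul_eq_mul,
            Nat.card_Ico]
      _ ≤ X * M * (1 / 4) + J * ((26 * N + 2 * J + 1) * R) := by
          gcongr
          · exact sum_half_pow_le a J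
          · omega
      _ = _ := by ring
  have hB : ∑ j ∈ Finset.Ico J (J + (s - 1)),
      ∑ n ∈ Finset.range X, w n * (hitCount hit (towerBlock j) n : ℝ) ≤
        (X * M / 4 + R) * (16 * N * s) := by
    calc _ ≤ ∑ j ∈ Finset.Ico J (J + (s - 1)), (X * M * (4 * N) + N * R) := by
          refine Finset.sum_le_sum fun j hj => ?_
          rw [Finset.mem_Ico] at hj
          refine (sum_towerWeight_mul_hitCount_le_of_le hN haJ hit_roots X hj.1).trans
            (add_le_add le_rfl ?_)
          have : (2 : ℝ) ^ 2 ^ (j + 1) ≤ U ^ 2 ^ (s - 1) := by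
            rw [hU, ← pow_mul, ← pow_add]
            exact pow_le_pow_right₀ one_le_two (Nat.pow_le_pow_right two_pos (by omega))
          calc (2 : ℝ) ^ 2 ^ (j + 1) * (N * U ^ (104 * N + 12))
              ≤ U ^ 2 ^ (s - 1) * (N * U ^ (104 * N + 12)) := by gcongr
            _ = N * U ^ (2 ^ (s - 1) + (104 * N + 12)) := by rw [pow_add]; ring
            _ ≤ N * R := by
              gcongr
              exact pow_le_pow_right₀ hU1 (by omega)
      _ = (s - 1 : ℕ) * (X * M * (4 * N) + N * R) := by
          rw [Finset.sum_const, nsmul_eq_mul, Nat.card_Ico, Nat.add_sub_cancel_left]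
      _ ≤ s * (X * M * (4 * N) + N * R) := by
          gcongr
          omega
      _ ≤ _ := by
          have : (0 : ℝ) ≤ s * N * R := by positivity
          linarith
  have hB' := (div_le_iff₀ hT).2 hB
  have hC : (((Finset.range X).filter bad).card : ℝ) ≤ 2 * N * R := by
    have : (((Finset.range X).filter bad).card : ℝ) * U ≤ 2 * N * X := by
      rw [hU]
      exact_mod_cast hbad
    rw [hXU] at this
    refine le_of_mul_le_mul_right (this.trans (le_of_eq (by ring))) (by positivity : 0 < U)
  have hmain : U * M ≤ 2 * (2 + 2 * N + J * (26 * N + 2 * J + 1)) := by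
    refine le_of_mul_le_mul_left ?_ hR0
    rw [hXU] at *
    nlinarith
  have hcontra : (2 * (2 + 2 * N + J * (26 * N + 2 * J + 1)) : ℝ) * 4 ^ (4 * N * J) < U := by
    rw [hU]
    exact_mod_cast const_mul_four_pow_lt hNJ hJ
  have hMl := pow_le_towerMean hN J
  have h5 : U * (1 / 4) ^ (4 * N * J) ≤ 2 * (2 + 2 * N + J * (26 * N + 2 * J + 1)) :=
    le_trans (by gcongr) hmain
  rw [one_div, inv_pow, ← div_eq_mul_inv, div_le_iff₀ (by positivity)] at h5
  linarith

theorem card_mul_card_sub_one_le_two_mul_sum (s : Finset ℕ) :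
    s.card * (s.card - 1) ≤ 2 * ∑ x ∈ s, x := by
  induction s using Finset.induction_on_max with
  | empty => simp
  | insert x s hx ih =>
    have hxs : x ∉ s := fun h => lt_irrefl _ (hx x h)
    have hc : s.card ≤ x := by
      have : s ⊆ Finset.range x := fun y hy => Finset.mem_range.2 (hx y hy)
      simpa using Finset.card_le_card this
    rw [Finset.card_insert_of_notMem hxs, Finset.sum_insert hxs, Nat.add_sub_cancel]
    rcases Nat.eq_zero_or_pos s.card with h0 | h0
    · simp [h0]
    · obtain ⟨c, hcs⟩ : ∃ c, s.card = c + 1 := ⟨s.card - 1, by omega⟩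
      rw [hcs] at ih hc ⊢
      simp only [Nat.add_sub_cancel] at ih
      nlinarith

theorem exists_ne_map_eq_of_sum_lt {N : ℕ} (f : Fin N → ℕ) (h : 2 * ∑ i, f i < N * (N - 1)) :
    ∃ i j, i ≠ j ∧ f i = f j := by
  by_contra! hf
  have hinj : Function.Injective f := fun i j hij => by
    by_contra hne
    exact hf i j hne hij
  have := card_mul_card_sub_one_le_two_mul_sum (Finset.univ.image f)
  rw [Finset.card_image_of_injective _ hinj, Finset.sum_image hinj.injOn, Finset.card_univ,
    Fintype.card_fin] at this
  omega

open Classical in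
theorem card_filter_sq_dvd_le {α γ z Y X : ℕ} (hz : 0 < z)
    (hα : ∀ p : ℕ, p.Prime → z < p → ¬ p ∣ α) (hγ : 0 < γ)
    (hY : ∀ n < X, α * n + γ < Y ^ 2) (hYX : Y * z ≤ X) :
    ((Finset.range X).filter fun n => ∃ p : ℕ, p.Prime ∧ z < p ∧ p ^ 2 ∣ α * n + γ).card * z ≤
      2 * X := by
  set P := (Finset.Ioc z (max z Y)).filter Nat.Prime with hP
  have hsub : ((Finset.range X).filter fun n => ∃ p : ℕ, p.Prime ∧ z < p ∧ p ^ 2 ∣ α * n + γ) ⊆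
      P.biUnion fun p => (Finset.range X).filter fun n => p ^ 2 ∣ α * n + γ := by
    intro n hn
    simp only [Finset.mem_filter, Finset.mem_range, Finset.mem_biUnion, hP, Finset.mem_Ioc]
      at hn ⊢
    obtain ⟨hn, p, hp, hzp, hd⟩ := hn
    have h1 : p ^ 2 < Y ^ 2 := (Nat.le_of_dvd (by omega) hd).trans_lt (hY n hn)
    have h2 : p < Y := lt_of_pow_lt_pow_left₀ 2 (by omega) h1
    exact ⟨p, ⟨⟨hzp, by omega⟩, hp⟩, hn, hd⟩
  have hone : ∀ p ∈ P, (((Finset.range X).filter fun n => p ^ 2 ∣ α * n + γ).card : ℝ) ≤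
      X * ((p : ℝ) ^ 2)⁻¹ + 1 := by
    intro p hp
    simp only [hP, Finset.mem_filter, Finset.mem_Ioc] at hp
    have hp0 : 0 < p ^ 2 := pow_pos hp.2.pos 2
    rcases Finset.eq_empty_or_nonempty
      ((Finset.range X).filter fun n => p ^ 2 ∣ α * n + γ) with he | ⟨m, hm⟩
    · rw [he]
      simp
      positivity
    · have hle : ((Finset.range X).filter fun n => p ^ 2 ∣ α * n + γ).card ≤
          X / p ^ 2 + 1 := by
        calc _ ≤ ((Finset.range X).filter fun n => n ≡ m [MOD p ^ 2]).card := by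
              refine Finset.card_le_card fun n hn => ?_
              simp only [Finset.mem_filter] at hn hm ⊢
              refine ⟨hn.1, ?_⟩
              have h1 : α * n + γ ≡ α * m + γ [MOD p ^ 2] :=
                ((Nat.modEq_zero_iff_dvd).2 hn.2).trans ((Nat.modEq_zero_iff_dvd).2 hm.2).symm
              have h2 := Nat.ModEq.add_right_cancel' γ h1
              refine Nat.ModEq.cancel_left_of_coprime ?_ h2
              exact Nat.Coprime.pow_left 2
                ((Nat.Prime.coprime_iff_not_dvd hp.2).2 (hα p hp.2 hp.1.1))
          _ ≤ _ := by
              rw [← Nat.count_eq_card_filter_range, Nat.count_modEq_card _ hp0]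
              split_ifs <;> omega
      calc _ ≤ ((X / p ^ 2 + 1 : ℕ) : ℝ) := by exact_mod_cast hle
        _ ≤ _ := by
          push_cast
          have := @Nat.cast_div_le ℝ _ _ _ X (p ^ 2)
          push_cast at this
          rw [div_eq_mul_inv] at this
          linarith
  have hz' : (0 : ℝ) < z := by exact_mod_cast hz
  have hPle : (P.card : ℝ) ≤ Y := by
    have : P.card ≤ Y := by
      refine (Finset.card_filter_le _ _).trans ?_
      rw [Nat.card_Ioc]
      omega
    exact_mod_cast this
  have hmain : (((Finset.range X).filter fun n => ∃ p : ℕ, p.Prime ∧ z < p ∧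
      p ^ 2 ∣ α * n + γ).card : ℝ) ≤ X * (z : ℝ)⁻¹ + Y := by
    calc _ ≤ ((∑ p ∈ P, ((Finset.range X).filter fun n => p ^ 2 ∣ α * n + γ).card : ℕ) : ℝ) := by
          exact_mod_cast (Finset.card_le_card hsub).trans Finset.card_biUnion_le
      _ ≤ ∑ p ∈ P, (X * ((p : ℝ) ^ 2)⁻¹ + 1) := by
          push_cast
          exact Finset.sum_le_sum hone
      _ = X * ∑ p ∈ P, ((p : ℝ) ^ 2)⁻¹ + P.card := by
          rw [Finset.sum_add_distrib, Finset.mul_sum]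
          simp
      _ ≤ X * (z : ℝ)⁻¹ + Y := by
          gcongr
          calc ∑ p ∈ P, ((p : ℝ) ^ 2)⁻¹ ≤ ∑ p ∈ Finset.Ioc z (max z Y), ((p : ℝ) ^ 2)⁻¹ :=
                Finset.sum_le_sum_of_subset_of_nonneg (Finset.filter_subset _ _)
                  fun _ _ _ => by positivity
            _ ≤ (z : ℝ)⁻¹ - ((max z Y : ℕ) : ℝ)⁻¹ :=
                sum_Ioc_inv_sq_le_sub hz.ne' (le_max_left _ _)
            _ ≤ (z : ℝ)⁻¹ := sub_le_self _ (by positivity)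
  have hYX' : (Y * z : ℝ) ≤ X := by exact_mod_cast hYX
  have : (((Finset.range X).filter fun n => ∃ p : ℕ, p.Prime ∧ z < p ∧
      p ^ 2 ∣ α * n + γ).card : ℝ) * z ≤ 2 * X := by
    calc _ ≤ (X * (z : ℝ)⁻¹ + Y) * z := by gcongr
      _ = X + Y * z := by field_simp
      _ ≤ 2 * X := by linarith
  exact_mod_cast this

theorem card_le_two_of_lt_cube {s : Finset ℕ} {v W : ℕ} (hW : 0 < W) (hv : 0 < v)
    (hvW : v < W ^ 3) (hs : s ⊆ v.primeFactors) (h : ∀ p ∈ s, W ≤ p) : s.card ≤ 2 := by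
  have h1 : W ^ s.card ≤ v := by
    calc W ^ s.card ≤ ∏ p ∈ s, p := Finset.pow_card_le_prod _ _ _ h
      _ ≤ v := Nat.le_of_dvd hv ((Finset.prod_dvd_prod_of_subset _ _ _ hs).trans
        (Nat.prod_primeFactors_dvd v))
  have h2 := h1.trans_lt hvW
  by_contra! h3
  exact absurd (Nat.pow_le_pow_right hW (show 3 ≤ s.card from h3)) (by omega)

/-- The linear forms `α i * n + γ i` have no prime factors up to `2 ^ 2 ^ a`, and modulo any
larger prime they have distinct roots. -/
structure SievableForms (N a : ℕ) (α γ : Fin N → ℕ) : Prop where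
  two_mul_le : 2 * N ≤ 2 ^ 2 ^ a
  one_lt : ∀ i, 1 < γ i
  lt_of_dvd : ∀ p : ℕ, p.Prime → ∀ i n, p ∣ α i * n + γ i → 2 ^ 2 ^ a < p
  not_dvd : ∀ p : ℕ, p.Prime → 2 ^ 2 ^ a < p → ∀ i, ¬ p ∣ α i
  eq_of_dvd : ∀ p : ℕ, p.Prime → 2 ^ 2 ^ a < p → ∀ n i j, p ∣ α i * n + γ i →
    p ∣ α j * n + γ j → i = j

theorem exists_dvd_mul_add {α p : ℕ} (hp : p.Prime) (hα : ¬ p ∣ α) (γ : ℕ) :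
    ∃ r, p ∣ α * r + γ := by
  have := Fact.mk hp
  have hα' : (α : ZMod p) ≠ 0 := by rwa [Ne, ZMod.natCast_eq_zero_iff]
  refine ⟨(-(γ : ZMod p) / α).val, ?_⟩
  rw [← ZMod.natCast_eq_zero_iff]
  push_cast
  rw [ZMod.natCast_zmod_val]
  field_simp
  ring

theorem SievableForms.hasRoots {N a : ℕ} {α γ : Fin N → ℕ} (h : SievableForms N a α γ) {p : ℕ}
    (hp : p.Prime) (hpa : 2 ^ 2 ^ a < p) :
    HasRoots N (fun p n => ∃ i, p ∣ α i * n + γ i) p := by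
  choose r hr using fun i => exists_dvd_mul_add hp (h.not_dvd p hp hpa i) (γ i)
  have key : ∀ i n, n ≡ r i [MOD p] → p ∣ α i * n + γ i := fun i n hn =>
    ((hn.mul_left (α i)).add_right (γ i)).dvd_iff dvd_rfl |>.2 (hr i)
  refine ⟨hp, r, fun n => ⟨?_, ?_⟩, fun i j hij => ?_⟩
  · rintro ⟨i, hi⟩
    refine ⟨i, ?_⟩
    have h1 : α i * n + γ i ≡ α i * r i + γ i [MOD p] :=
      ((Nat.modEq_zero_iff_dvd).2 hi).trans ((Nat.modEq_zero_iff_dvd).2 (hr i)).symm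
    exact Nat.ModEq.cancel_left_of_coprime
      ((Nat.Prime.coprime_iff_not_dvd hp).2 (h.not_dvd p hp hpa i))
      (Nat.ModEq.add_right_cancel' _ h1)
  · rintro ⟨i, hi⟩
    exact ⟨i, key i n hi⟩
  · exact h.eq_of_dvd p hp hpa (r i) i j (hr i) (key j _ hij)

theorem hitCount_eq (hit : ℕ → ℕ → Prop) (Q : Finset ℕ) (n : ℕ)
    [DecidablePred fun p => hit p n] :
    hitCount hit Q n = (Q.filter fun p => hit p n).card := by
  unfold hitCount
  congr

theorem hitCount_eq_zero {hit : ℕ → ℕ → Prop} {Q : Finset ℕ} {n : ℕ} :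
    hitCount hit Q n = 0 ↔ ∀ p ∈ Q, ¬ hit p n := by
  classical
  rw [hitCount_eq, Finset.card_eq_zero, Finset.filter_eq_empty_iff]

open Classical in
theorem SievableForms.sum_card_le {N a : ℕ} {α γ : Fin N → ℕ} (h : SievableForms N a α γ)
    {J n : ℕ} (haJ : a ≤ J) (b : ℕ) :
    ∑ i, ((Finset.Ico J b).biUnion towerBlock |>.filter fun p => p ∣ α i * n + γ i).card ≤
      ∑ j ∈ Finset.Ico J b, hitCount (fun p n => ∃ i, p ∣ α i * n + γ i) (towerBlock j) n := by
  have hP : ∀ p ∈ (Finset.Ico J b).biUnion towerBlock, p.Prime ∧ 2 ^ 2 ^ a < p := by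
    intro p hp
    obtain ⟨j, hj, hp⟩ := Finset.mem_biUnion.1 hp
    rw [mem_towerBlock] at hp
    refine ⟨hp.2, lt_of_le_of_lt ?_ hp.1.1⟩
    exact Nat.pow_le_pow_right two_pos
      (Nat.pow_le_pow_right two_pos (haJ.trans (Finset.mem_Ico.1 hj).1))
  rw [← Finset.card_biUnion]
  · calc _ ≤ ((Finset.Ico J b).biUnion fun j =>
          (towerBlock j).filter fun p => ∃ i, p ∣ α i * n + γ i).card := by
          refine Finset.card_le_card fun p hp => ?_
          simp only [Finset.mem_biUnion, Finset.mem_filter, Finset.mem_univ, true_and] at hp ⊢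
          obtain ⟨i, ⟨j, hj, hpj⟩, hpi⟩ := hp
          exact ⟨j, hj, hpj, i, hpi⟩
      _ ≤ _ := Finset.card_biUnion_le.trans
          (Finset.sum_le_sum fun j _ => (hitCount_eq (fun p n => ∃ i, p ∣ α i * n + γ i) _ _).ge)
  · intro i _ j _ hij
    rw [Function.onFun, Finset.disjoint_left]
    intro p hpi hpj
    rw [Finset.mem_filter] at hpi hpj
    obtain ⟨hp, hpa⟩ := hP p hpi.1
    exact hij (h.eq_of_dvd p hp hpa n i j hpi.2 hpj.2)

theorem SievableForms.exists_card_primeFactors_eq {N a s : ℕ} {α γ : Fin N → ℕ}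
    (h : SievableForms N a α γ) (hs : 2 * (104 * N + 13) ≤ 2 ^ s) (hNs : 32 * s + 5 ≤ N) (Z : ℕ) :
    ∃ n, (∀ i, Squarefree (α i * n + γ i)) ∧
      (∀ i, ∀ p : ℕ, p.Prime → p ∣ α i * n + γ i → Z < p) ∧
      ∃ i j, i ≠ j ∧
        (α i * n + γ i).primeFactors.card = (α j * n + γ j).primeFactors.card := by
  classical
  have hs2 : 2 ≤ s := by
    by_contra! hlt
    interval_cases s <;> omega
  obtain ⟨J, haJ, hNJ, hJ, hZJ, hαγ⟩ : ∃ J, a ≤ J ∧ N ≤ J ∧ 10 ≤ J ∧ Z ≤ J ∧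
      ∑ i, (α i + γ i) ≤ J :=
    ⟨a + N + 10 + Z + ∑ i, (α i + γ i), by omega, by omega, by omega, by omega, by omega⟩
  have hlt : ∀ m, m < 2 ^ 2 ^ m := fun m =>
    Nat.lt_two_pow_self.trans (Nat.pow_lt_pow_right one_lt_two Nat.lt_two_pow_self)
  have hmono : ∀ m m', m ≤ m' → 2 ^ 2 ^ m ≤ 2 ^ 2 ^ m' := fun m m' hm =>
    Nat.pow_le_pow_right two_pos (Nat.pow_le_pow_right two_pos hm)
  set X : ℕ := 2 ^ 2 ^ (J + s) with hX
  set W : ℕ := 2 ^ 2 ^ (J + (s - 1)) with hW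
  set V : ℕ := 2 ^ 2 ^ (J + (s - 2)) with hV
  have hWV : W = V ^ 2 := by
    rw [hW, hV, ← pow_mul, ← pow_succ]
    congr 2
    omega
  have hXW : X = W ^ 2 := by
    rw [hW, hX, ← pow_mul, ← pow_succ]
    congr 2
    omega
  have hW0 : 0 < W := by positivity
  have hzV : 2 ^ 2 ^ J ≤ V := hmono _ _ (by omega)
  have hsize : ∀ i, ∀ n < X, α i * n + γ i < W ^ 3 := by
    intro i n hn
    have h1 : α i + γ i ≤ J :=
      (Finset.single_le_sum (f := fun i => α i + γ i) (fun _ _ => Nat.zero_le _)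
        (Finset.mem_univ i)).trans hαγ
    have h2 : α i + γ i < W := (h1.trans_lt (hlt J)).trans_le (hmono _ _ (by omega))
    have h3 : α i * n ≤ α i * X := Nat.mul_le_mul_left _ hn.le
    have h4 : γ i ≤ γ i * X := Nat.le_mul_of_pos_right _ (by omega)
    have h5 : (α i + γ i) * X < W * X := Nat.mul_lt_mul_of_pos_right h2 (by omega)
    rw [hXW] at *
    nlinarith
  set bad : ℕ → Prop := fun n => ∃ i, ∃ p : ℕ, p.Prime ∧ 2 ^ 2 ^ J < p ∧
    p ^ 2 ∣ α i * n + γ i with hbad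
  have hcount : ((Finset.range X).filter bad).card * 2 ^ 2 ^ J ≤ 2 * N * X := by
    have h1 : (Finset.range X).filter bad ⊆ Finset.univ.biUnion fun i : Fin N =>
        (Finset.range X).filter fun n => ∃ p : ℕ, p.Prime ∧ 2 ^ 2 ^ J < p ∧
          p ^ 2 ∣ α i * n + γ i := by
      intro n hn
      simp only [Finset.mem_filter, Finset.mem_biUnion, Finset.mem_univ, true_and, hbad] at hn ⊢
      obtain ⟨hn, i, hp⟩ := hn
      exact ⟨i, hn, hp⟩
    calc _ ≤ (∑ i : Fin N, ((Finset.range X).filter fun n => ∃ p : ℕ, p.Prime ∧ 2 ^ 2 ^ J < p ∧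
          p ^ 2 ∣ α i * n + γ i).card) * 2 ^ 2 ^ J :=
          Nat.mul_le_mul_right _ ((Finset.card_le_card h1).trans Finset.card_biUnion_le)
      _ ≤ ∑ i : Fin N, 2 * X := by
          rw [Finset.sum_mul]
          refine Finset.sum_le_sum fun i _ => card_filter_sq_dvd_le (Y := V ^ 3) (by positivity)
            (fun p hp hpJ => h.not_dvd p hp ((hmono _ _ haJ).trans_lt hpJ) i)
            (by have := h.one_lt i; omega) (fun n hn => ?_) ?_
          · have := hsize i n hn
            rw [hWV] at this
            calc _ < (V ^ 2) ^ 3 := this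
              _ = _ := by ring
          · calc V ^ 3 * 2 ^ 2 ^ J ≤ V ^ 3 * V := Nat.mul_le_mul_left _ hzV
              _ = X := by rw [hXW, hWV]; ring
      _ = 2 * N * X := by
          simp
          ring
  obtain ⟨n, hnX, hn0, hnbad, hnT⟩ := exists_sifted (by omega) h.two_mul_le haJ hs hNJ hJ
    (fun p hp hpa => h.hasRoots hp hpa) bad hcount
  have hlarge : ∀ i, ∀ p : ℕ, p.Prime → p ∣ α i * n + γ i → 2 ^ 2 ^ J < p := by
    intro i p hp hpi
    by_contra! hle
    obtain ⟨j, hj, hpj⟩ := exists_mem_towerBlock hp (h.lt_of_dvd p hp i n hpi) hle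
    exact hitCount_eq_zero.1 (hn0 j hj) p hpj ⟨i, hpi⟩
  have hpos : ∀ i, 0 < α i * n + γ i := fun i => by
    have := h.one_lt i
    omega
  have hcard : ∀ i, (α i * n + γ i).primeFactors.card ≤ 2 +
      ((Finset.Ico J (J + (s - 1))).biUnion towerBlock |>.filter
        fun p => p ∣ α i * n + γ i).card := by
    intro i
    rw [← Finset.card_filter_add_card_filter_not (s := (α i * n + γ i).primeFactors)
      (p := fun p => W ≤ p)]
    refine Nat.add_le_add (card_le_two_of_lt_cube hW0 (hpos i) (hsize i n hnX)
      (Finset.filter_subset _ _) fun p hp => (Finset.mem_filter.1 hp).2)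
      (Finset.card_le_card fun p hp => ?_)
    rw [Finset.mem_filter, Nat.mem_primeFactors] at hp
    obtain ⟨⟨hp, hpi, -⟩, hpW⟩ := hp
    rw [Finset.mem_filter, Finset.mem_biUnion]
    exact ⟨exists_mem_towerBlock hp (hlarge i p hp hpi) (by omega), hpi⟩
  refine ⟨n, fun i => ?_, fun i p hp hpi => ?_, exists_ne_map_eq_of_sum_lt _ ?_⟩
  · rw [Nat.squarefree_iff_prime_squarefree]
    intro p hp hpp
    exact hnbad ⟨i, p, hp, hlarge i p hp (dvd_of_mul_left_dvd hpp), by rwa [pow_two]⟩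
  · have := hlt J
    have := hlarge i p hp hpi
    omega
  · have h1 : ∑ i, (α i * n + γ i).primeFactors.card ≤ N * 2 +
        ∑ j ∈ Finset.Ico J (J + (s - 1)), hitCount (fun p n => ∃ i, p ∣ α i * n + γ i) (towerBlock j) n := by
      refine (Finset.sum_le_sum fun i _ => hcard i).trans ?_
      rw [Finset.sum_add_distrib]
      refine Nat.add_le_add (by simp) (h.sum_card_le haJ _)
    have h2 : N * (32 * s + 4) ≤ N * (N - 1) := Nat.mul_le_mul_left _ (by omega)
    nlinarith

theorem exists_injective_prime_gt (ι : Type*) [Finite ι] (n : ℕ) :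
    ∃ q : ι → ℕ, Function.Injective q ∧ ∀ i, (q i).Prime ∧ n < q i := by
  have hinf : {p : ℕ | p.Prime ∧ n < p}.Infinite :=
    Set.infinite_of_not_bddAbove fun ⟨M, hM⟩ => by
      obtain ⟨p, hp, hpp⟩ := Nat.exists_infinite_primes (n + M + 1)
      have := hM (show p ∈ {p : ℕ | p.Prime ∧ n < p} from ⟨hpp, by omega⟩)
      omega
  obtain ⟨e⟩ : Nonempty (ι ↪ ℕ) := ⟨(Finite.equivFin ι).toEmbedding.trans Fin.valEmbedding⟩
  exact ⟨fun i => hinf.natEmbedding _ (e i),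
    fun i j h => e.injective ((hinf.natEmbedding _).injective (Subtype.ext h)),
    fun i => (hinf.natEmbedding _ (e i)).2⟩

theorem exists_modEq_and_forall_modEq {ι : Type*} [Fintype ι] {M : ℕ} {s : ι → ℕ}
    (hs : ∀ i, s i ≠ 0) (hcop : Pairwise fun i j => (s i).Coprime (s j))
    (hM : ∀ i, M.Coprime (s i)) (c : ℕ) (r : ι → ℕ) :
    ∃ x, x ≡ c [MOD M] ∧ ∀ i, x ≡ r i [MOD s i] := by
  obtain ⟨y, hy⟩ := Nat.chineseRemainderOfFinset r s Finset.univ (fun i _ => hs i)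
    fun i _ j _ hij => hcop hij
  obtain ⟨x, hx, hxy⟩ := Nat.chineseRemainder
    (Nat.Coprime.prod_right fun i _ => hM i : M.Coprime (∏ i, s i)) c y
  exact ⟨x, hx, fun i =>
    (hxy.of_dvd (Finset.dvd_prod_of_mem s (Finset.mem_univ i))).trans (hy i (Finset.mem_univ i))⟩

theorem dk_prod {ι : Type*} (k : ℕ) (s : Finset ι) {u : ι → ℕ}
    (h : Pairwise fun i j => (u i).Coprime (u j)) :
    dk k (∏ i ∈ s, u i) = ∏ i ∈ s, dk k (u i) := by
  classical
  induction s using Finset.induction_on with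
  | empty => simp [dk, Finset.filter_singleton]
  | insert i s hi ih =>
    rw [Finset.prod_insert hi, Finset.prod_insert hi, dk_mul, ih]
    exact Nat.Coprime.prod_right fun j hj => h (by rintro rfl; exact hi hj)

/-- A finite family of integers `a i` with weights `f i` such that, for `d = a j - a i > 0`, the
quotient of `dk k (B * (a j / d))` and `dk k (B * (a i / d))` is `f j / f i`. -/
structure WeightedTuple {ι : Type} (k B : ℕ) (a f : ι → ℕ) : Prop where
  pos : ∀ i, 0 < a i
  weight_pos : ∀ i, 0 < f i
  injective : Function.Injective a
  sub_dvd : ∀ i j, a i < a j → a j - a i ∣ a i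
  weight_mul : ∀ i j, a i < a j →
    f j * dk k (B * (a i / (a j - a i))) = f i * dk k (B * (a j / (a j - a i)))

namespace WeightedTuple

variable {ι : Type} {k B : ℕ} {a f : ι → ℕ}

theorem sub_dvd_right (h : WeightedTuple k B a f) {i j : ι} (hij : a i < a j) :
    a j - a i ∣ a j := by
  have := (Nat.dvd_add_right (h.sub_dvd i j hij)).2 (dvd_refl (a j - a i))
  rwa [Nat.add_sub_cancel' hij.le] at this

theorem const_mul (h : WeightedTuple k B a f) {c : ℕ} (hc : 0 < c) :
    WeightedTuple k B a fun i => c * f i where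
  pos := h.pos
  weight_pos i := Nat.mul_pos hc (h.weight_pos i)
  injective := h.injective
  sub_dvd := h.sub_dvd
  weight_mul i j hij := by rw [mul_assoc, h.weight_mul i j hij, mul_assoc]

theorem translate (h : WeightedTuple k B a f) {A : ℕ} {c : ι → ℕ} (hc : ∀ i, a i * c i = A)
    (hcop : ∀ i, (c i + 1).Coprime (B * a i)) :
    WeightedTuple k B (fun i => a i * (c i + 1)) fun i => f i * dk k (c i + 1) := by
  have ha : ∀ i, a i * (c i + 1) = A + a i := fun i => by rw [mul_add, hc, mul_one]
  have hlt : ∀ i j, a i * (c i + 1) < a j * (c j + 1) → a i < a j := fun i j hij => by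
    rw [ha, ha] at hij
    omega
  have hsub : ∀ i j, a j * (c j + 1) - a i * (c i + 1) = a j - a i := fun i j => by
    rw [ha, ha]
    omega
  have hdk : ∀ i d, d ∣ a i →
      dk k (B * (a i * (c i + 1) / d)) = dk k (B * (a i / d)) * dk k (c i + 1) := by
    intro i d hd
    rw [← Nat.div_mul_right_comm hd, ← mul_assoc, dk_mul]
    exact ((hcop i).coprime_dvd_right (Nat.mul_dvd_mul_left _ (Nat.div_dvd_of_dvd hd))).symm
  refine ⟨fun i => Nat.mul_pos (h.pos i) (Nat.succ_pos _),
    fun i => Nat.mul_pos (h.weight_pos i) (dk_pos (Nat.succ_pos _)), fun i j hij => ?_,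
    fun i j hij => ?_, fun i j hij => ?_⟩
  · simp only [ha] at hij
    exact h.injective (by omega)
  · rw [hsub]
    exact (h.sub_dvd i j (hlt i j hij)).mul_right _
  · have hij' := hlt i j hij
    rw [hsub, hdk i _ (h.sub_dvd i j hij'), hdk j _ (h.sub_dvd_right hij')]
    have := h.weight_mul i j hij'
    linear_combination (dk k (c i + 1) * dk k (c j + 1)) * this

theorem extend (h : WeightedTuple k B a f) (hB : 0 < B) {A C : ℕ} (hA : 0 < A) (hC : 0 < C)
    {c : ι → ℕ} (hc : ∀ i, a i * c i = A) (hcop : ∀ i, (c i + 1).Coprime (B * a i))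
    (hf : ∀ i, f i * dk k (B * c i) = C) :
    ∃ a' f' : Option ι → ℕ, WeightedTuple k B a' f' := by
  have ha : ∀ i, a i * (c i + 1) = A + a i := fun i => by rw [mul_add, hc, mul_one]
  have ht := (h.translate hc hcop).const_mul (dk_pos (k := k) hB)
  refine ⟨fun o => o.elim A fun i => a i * (c i + 1),
    fun o => o.elim C fun i => dk k B * (f i * dk k (c i + 1)), ⟨?_, ?_, ?_, ?_, ?_⟩⟩
  · rintro (_ | i)
    · exact hA
    · exact ht.pos i
  · rintro (_ | i)
    · exact hC
    · exact ht.weight_pos i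
  · rintro (_ | i) (_ | j) hij
    · rfl
    · have := h.pos j
      simp only [Option.elim, ha] at hij
      omega
    · have := h.pos i
      simp only [Option.elim, ha] at hij
      omega
    · exact congrArg some (ht.injective hij)
  · rintro (_ | i) (_ | j) hij
    · exact absurd hij (lt_irrefl _)
    · simp only [Option.elim, ha, Nat.add_sub_cancel_left]
      exact ⟨c j, (hc j).symm⟩
    · simp only [Option.elim, ha] at hij
      omega
    · exact ht.sub_dvd i j hij
  · rintro (_ | i) (_ | j) hij
    · exact absurd hij (lt_irrefl _)
    · have h1 : a j * (c j + 1) - A = a j := by rw [ha, Nat.add_sub_cancel_left]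
      have h2 : A / a j = c j := by rw [← hc j, Nat.mul_div_cancel_left _ (h.pos j)]
      simp only [Option.elim, h1, h2, Nat.mul_div_cancel_left _ (h.pos j)]
      rw [dk_mul ((hcop j).coprime_dvd_right (dvd_mul_right _ _)).symm, ← hf j]
      ring
    · simp only [Option.elim, ha] at hij
      omega
    · exact ht.weight_mul i j hij

end WeightedTuple

theorem exists_eq_pow_mul_of_modEq {q m w : ℕ} (hq : 1 < q) (h : m ≡ q ^ w [MOD q ^ (w + 1)]) :
    ∃ r, m = q ^ w * r ∧ ¬ q ∣ r := by
  have h1 : q ^ w ∣ m := (h.of_dvd (pow_dvd_pow q w.le_succ)).dvd_iff dvd_rfl |>.2 dvd_rfl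
  obtain ⟨r, rfl⟩ := h1
  refine ⟨r, rfl, fun hr => ?_⟩
  have h2 : q ^ w * r ≡ q ^ w * 1 [MOD q ^ w * q] := by rwa [← pow_succ, mul_one]
  have h3 := Nat.ModEq.mul_left_cancel' (by positivity) h2
  have h4 : q ∣ 1 := (h3.dvd_iff dvd_rfl).1 hr
  exact absurd (Nat.le_of_dvd one_pos h4) (by omega)

theorem WeightedTuple.exists_translate_eq_pow_mul {ι : Type} [Fintype ι] {k B : ℕ} {a f : ι → ℕ}
    (h : WeightedTuple k B a f) {G : ℕ} {g q : ι → ℕ} (hg : ∀ i, a i * g i = G)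
    (hq : ∀ i, (q i).Prime) (hqG : ∀ i, (q i).Coprime G) (hqi : Function.Injective q)
    {w : ℕ} (hw : 0 < w) :
    ∃ (A : ℕ) (c r : ι → ℕ), (∀ i, a i * c i = A) ∧ (∀ i, c i + 1 = q i ^ w * r i) ∧
      (∀ i, G ∣ c i) ∧ Pairwise (fun i j => (r i).Coprime (r j)) ∧
      ∀ i j, (r i).Coprime (q j) := by
  have ha : ∀ i, (a i).Coprime (q i ^ (w + 1)) := fun i =>
    (((hqG i).coprime_dvd_right ⟨g i, (hg i).symm⟩).symm).pow_right _
  obtain ⟨x, hx, hxi⟩ := exists_modEq_and_forall_modEq (M := G * G) (s := fun i => q i ^ (w + 1))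
    (fun i => (pow_pos (hq i).pos _).ne')
    (fun i j hij => Nat.Coprime.pow _ _ ((Nat.coprime_primes (hq i) (hq j)).2 (hqi.ne hij)))
    (fun i => (((hqG i).mul_right (hqG i)).symm).pow_right _) 0
    fun i => a i * (q i ^ w - 1)
  obtain ⟨t, rfl⟩ := (Nat.modEq_zero_iff_dvd).1 hx
  set c : ι → ℕ := fun i => G * (g i * t) with hcdef
  have hc : ∀ i, a i * c i = G * G * t := fun i => by
    rw [hcdef]
    simp only
    nth_rewrite 3 [← hg i]
    ring
  have hm : ∀ i, c i + 1 ≡ q i ^ w [MOD q i ^ (w + 1)] := by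
    intro i
    have h1 : a i * (c i + 1) ≡ a i * q i ^ w [MOD q i ^ (w + 1)] := by
      have h2 := (hxi i).add_right (a i)
      rw [← hc i, ← Nat.mul_add_one, ← Nat.mul_add_one,
        Nat.sub_add_cancel (Nat.one_le_pow _ _ (hq i).pos)] at h2
      exact h2
    exact Nat.ModEq.cancel_left_of_coprime (ha i).symm h1
  choose r hr hqr using fun i => exists_eq_pow_mul_of_modEq (hq i).one_lt (hm i)
  have hGc : ∀ i, G ∣ c i := fun i => dvd_mul_right _ _
  have hmcop : ∀ i j, a i < a j → (c i + 1).Coprime (c j + 1) := by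
    intro i j hij
    refine Nat.coprime_of_dvd fun p hp hpi hpj => ?_
    have h1 : p ∣ a j - a i := by
      have h2 := Nat.dvd_sub (hpj.mul_left (a j)) (hpi.mul_left (a i))
      rwa [mul_add, mul_add, hc, hc, mul_one, mul_one, Nat.add_sub_add_left] at h2
    have h3 : p ∣ G := (h1.trans (h.sub_dvd i j hij)).trans ⟨g i, (hg i).symm⟩
    exact hp.one_lt.ne' (Nat.dvd_one.1 ((Nat.dvd_add_right (h3.trans (hGc i))).1 hpi))
  have hmcop' : ∀ i j, i ≠ j → (c i + 1).Coprime (c j + 1) := by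
    intro i j hij
    rcases lt_or_gt_of_ne (h.injective.ne hij) with h1 | h1
    · exact hmcop i j h1
    · exact (hmcop j i h1).symm
  refine ⟨_, c, r, hc, hr, hGc, fun i j hij => ?_, fun i j => ?_⟩
  · have := hmcop' i j hij
    rw [hr, hr] at this
    exact this.coprime_mul_left.coprime_mul_left_right
  · rcases eq_or_ne i j with rfl | hij
    · exact ((Nat.Prime.coprime_iff_not_dvd (hq i)).2 (hqr i)).symm
    · have := hmcop' i j hij
      rw [hr, hr] at this
      exact (this.coprime_mul_left.coprime_mul_right_right).coprime_dvd_right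
        (dvd_pow_self _ hw.ne')

theorem exists_coprime_mul_add_one {ι : Type} [Fintype ι] {M : ℕ} {r E : ι → ℕ}
    (hM : 2 ∣ M) (hrM : ∀ i, M.Coprime (r i)) (hr0 : ∀ i, 0 < r i)
    (hr : Pairwise fun i j => (r i).Coprime (r j)) (hE : ∀ i, (E i).Coprime (r i)) :
    ∃ Q, 0 < Q ∧ Q.Coprime M ∧ (∀ i, Q.Coprime (r i)) ∧ ∀ i, (Q * E i + 1).Coprime (r i) := by
  have hinv : ∀ i, ∃ y, y * E i ≡ 1 [MOD r i] := by
    intro i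
    rcases eq_or_ne (r i) 1 with h1 | h1
    · exact ⟨0, by rw [h1]; exact Nat.modEq_one⟩
    · obtain ⟨y, hy⟩ := Nat.exists_mul_mod_eq_one_of_coprime (hE i)
        (lt_of_le_of_ne (hr0 i) (Ne.symm h1))
      refine ⟨y, ?_⟩
      rw [mul_comm]
      have := hr0 i
      have h2 : 1 % r i = 1 := Nat.mod_eq_of_lt (by omega)
      unfold Nat.ModEq
      rw [hy.2, h2]
  choose y hy using hinv
  obtain ⟨Q, hQM, hQ⟩ := exists_modEq_and_forall_modEq (fun i => (hr0 i).ne') hr hrM 1 y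
  have hQE : ∀ i, Q * E i ≡ 1 [MOD r i] := fun i => ((hQ i).mul_right _).trans (hy i)
  have hcopM : Q.Coprime M := by
    rw [Nat.coprime_iff_gcd_eq_one, hQM.gcd_eq, Nat.gcd_one_left]
  refine ⟨Q, ?_, hcopM, fun i => ?_, fun i => ?_⟩
  · refine Nat.pos_of_ne_zero fun h0 => ?_
    rw [h0, Nat.coprime_zero_left] at hcopM
    omega
  · have : (Q * E i).Coprime (r i) := by
      rw [Nat.coprime_iff_gcd_eq_one, (hQE i).gcd_eq, Nat.gcd_one_left]
    exact this.coprime_mul_right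
  · have : Q * E i + 1 ≡ 2 [MOD r i] := (hQE i).add_right 1
    rw [Nat.coprime_iff_gcd_eq_one, this.gcd_eq]
    exact (hrM i).coprime_dvd_left hM

theorem coprime_add_one_of_dvd {G c : ℕ} (h : G ∣ c) : (c + 1).Coprime G :=
  (Nat.coprime_self_add_left.2 (Nat.coprime_one_left c)).coprime_dvd_right h

theorem exists_weights_eq_add {ι : Type} [Fintype ι] (D : ι → ℕ) (hD : ∀ i, 2 ≤ D i) :
    ∃ (w : ℕ) (e : ι → ℕ), 0 < w ∧ (∀ i, 0 < e i) ∧ ∀ i, D i * (e i + 1) = w + e i + 1 := by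
  classical
  have hpos : ∀ s : Finset ι, 0 < ∏ i ∈ s, (D i - 1) := fun s =>
    Finset.prod_pos fun i _ => by have := hD i; omega
  refine ⟨2 * ∏ i, (D i - 1), fun i => 2 * (∏ l ∈ Finset.univ.erase i, (D l - 1)) - 1,
    Nat.mul_pos two_pos (hpos _), fun i => ?_, fun i => ?_⟩
  · have := hpos (Finset.univ.erase i)
    dsimp only
    omega
  · rw [← Finset.mul_prod_erase _ _ (Finset.mem_univ i)]
    have h1 := hpos (Finset.univ.erase i)
    set P := ∏ l ∈ Finset.univ.erase i, (D l - 1)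
    obtain ⟨d, hd⟩ : ∃ d, D i = d + 1 := ⟨D i - 1, by have := hD i; omega⟩
    obtain ⟨p, hp⟩ : ∃ p, P = p + 1 := ⟨P - 1, by omega⟩
    change D i * (2 * P - 1 + 1) = 2 * ((D i - 1) * P) + (2 * P - 1) + 1
    rw [hd, hp, Nat.add_sub_cancel, show 2 * (p + 1) - 1 = 2 * p + 1 by omega]
    ring

theorem WeightedTuple.exists_option {ι : Type} [Fintype ι] {k B : ℕ} (hk : 0 < k) (hB : 0 < B)
    {a f : ι → ℕ} (h₀ : WeightedTuple k B a f) :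
    ∃ a' f' : Option ι → ℕ, WeightedTuple k B a' f' := by
  classical
  have h := h₀.const_mul two_pos
  have ha : 0 < ∏ i, a i := Finset.prod_pos fun i _ => h.pos i
  set G := 2 * k * B * ∏ i, a i with hG
  have hG0 : 0 < G := by positivity
  have h2G : 2 ∣ G := ⟨k * B * ∏ i, a i, by rw [hG]; ring⟩
  have hkG : k ∣ G := ⟨2 * B * ∏ i, a i, by rw [hG]; ring⟩
  have hBG : B ∣ G := ⟨2 * k * ∏ i, a i, by rw [hG]; ring⟩
  have haG : ∀ i, a i ∣ G := fun i =>
    (Finset.dvd_prod_of_mem a (Finset.mem_univ i)).mul_left _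
  choose g hg using haG
  have hg0 : ∀ i, 0 < g i := fun i => Nat.pos_of_ne_zero fun h0 => by
    have := hg i
    rw [h0] at this
    omega
  obtain ⟨q, hqi, hq⟩ := exists_injective_prime_gt ι G
  have hqG : ∀ i, (q i).Coprime G := fun i =>
    (Nat.Prime.coprime_iff_not_dvd (hq i).1).2 fun hd =>
      absurd (Nat.le_of_dvd hG0 hd) (by have := (hq i).2; omega)
  obtain ⟨w, e, hw, he, hD⟩ := exists_weights_eq_add
    (fun i => 2 * f i * dk k (B * (G * g i))) fun i => by
      have h1 := h₀.weight_pos i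
      have h2 : 0 < dk k (B * (G * g i)) :=
        dk_pos (Nat.mul_pos hB (Nat.mul_pos hG0 (hg0 i)))
      calc 2 = 2 * 1 * 1 := rfl
        _ ≤ _ := Nat.mul_le_mul (Nat.mul_le_mul_left _ h1) h2
  obtain ⟨A, c, r, hc, hcr, hGc, hrr, hrq⟩ :=
    h.exists_translate_eq_pow_mul (fun i => (hg i).symm) (fun i => (hq i).1) hqG hqi hw
  have hGr : ∀ i, G.Coprime (r i) := fun i => by
    have := coprime_add_one_of_dvd (hGc i)
    rw [hcr] at this
    exact (Nat.Coprime.coprime_mul_left this).symm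
  have hr0 : ∀ i, 0 < r i := fun i => Nat.pos_of_ne_zero fun h0 => by
    have := hcr i
    rw [h0] at this
    omega
  have hqq : ∀ i j, i ≠ j → (q i).Coprime (q j) := fun i j hij =>
    (Nat.coprime_primes (hq i).1 (hq j).1).2 (hqi.ne hij)
  set u : ι → ℕ := fun l => q l ^ (w + e l) * r l with hu
  have hu0 : ∀ l, 0 < u l := fun l => Nat.mul_pos (pow_pos (hq l).1.pos _) (hr0 l)
  have huu : Pairwise fun i j => (u i).Coprime (u j) := fun i j hij =>
    Nat.Coprime.mul_left
      (((hqq i j hij).pow _ _).mul_right ((hrq j i).symm.pow_left _))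
      (((hrq i j).pow_right _).mul_right (hrr hij))
  have hGu : ∀ l, G.Coprime (u l) := fun l => ((hqG l).symm.pow_right _).mul_right (hGr l)
  have hgG : ∀ i, ∀ {x : ℕ}, G.Coprime x → (G * g i).Coprime x := fun i x hx =>
    hx.mul_left (hx.coprime_dvd_left ⟨a i, by rw [mul_comm, ← hg i]⟩)
  have hprod : ∀ i, ∏ l, u l = u i * ∏ l ∈ Finset.univ.erase i, u l := fun i =>
    (Finset.mul_prod_erase _ _ (Finset.mem_univ i)).symm
  have herase : ∀ i, ∀ {x : ℕ}, (∀ l, l ≠ i → x.Coprime (u l)) →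
      x.Coprime (∏ l ∈ Finset.univ.erase i, u l) := fun i x hx =>
    Nat.Coprime.prod_right fun l hl => hx l (Finset.ne_of_mem_erase hl)
  obtain ⟨Q, hQ0, hQM, hQr, hQE⟩ := exists_coprime_mul_add_one (M := G * ∏ i, q i) (r := r)
    (E := fun i => G * g i * (q i ^ e i * ∏ l ∈ Finset.univ.erase i, u l)) (h2G.mul_right _)
    (fun i => (hGr i).mul_left (Nat.Coprime.prod_left fun l _ => (hrq i l).symm)) hr0 hrr
    (fun i => (hgG i (hGr i)).mul_left (((hrq i i).symm.pow_left _).mul_left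
      (herase i fun l hl => ((hrq i l).pow_right _).mul_right (hrr hl.symm)).symm))
  have hQG : G.Coprime Q := hQM.coprime_mul_right_right.symm
  have hQq : ∀ i, Q.Coprime (q i) := fun i =>
    hQM.coprime_mul_left_right.coprime_dvd_right (Finset.dvd_prod_of_mem q (Finset.mem_univ i))
  have hQu : ∀ l, Q.Coprime (u l) := fun l => ((hQq l).pow_right _).mul_right (hQr l)
  have hdku : ∀ l, dk k (u l) = (w + e l + 1) * dk k (r l) := fun l => by
    rw [hu]
    dsimp only
    rw [dk_mul ((hrq l l).symm.pow_left _), dk_prime_pow (hq l).1]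
    exact fun hd => (Nat.Prime.coprime_iff_not_dvd (hq l).1).1 (hqG l) (hd.trans hkG)
  refine (h.translate hc fun i => ?_).extend hB (A := Q * (G * G * ∏ l, u l))
    (C := (w + 1) * dk k Q * ∏ l, dk k (u l))
    (c := fun i => Q * (G * g i * (q i ^ e i * ∏ l ∈ Finset.univ.erase i, u l)))
    ?_ ?_ (fun i => ?_) (fun i => ?_) fun i => ?_
  · exact (coprime_add_one_of_dvd (hGc i)).coprime_dvd_right hBG |>.mul_right
      ((coprime_add_one_of_dvd (hGc i)).coprime_dvd_right ⟨g i, hg i⟩)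
  · exact Nat.mul_pos hQ0 (Nat.mul_pos (Nat.mul_pos hG0 hG0) (Finset.prod_pos fun l _ => hu0 l))
  · exact Nat.mul_pos (Nat.mul_pos w.succ_pos (dk_pos hQ0))
      (Finset.prod_pos fun l _ => dk_pos (hu0 l))
  · rw [hprod i, hcr i]
    nth_rewrite 3 [hg i]
    rw [hu]
    ring
  · have h1 : (Q * (G * g i * (q i ^ e i * ∏ l ∈ Finset.univ.erase i, u l)) + 1).Coprime G :=
      coprime_add_one_of_dvd (((dvd_mul_right G (g i)).mul_right _).mul_left Q)
    have h2 : (Q * (G * g i * (q i ^ e i * ∏ l ∈ Finset.univ.erase i, u l)) + 1).Coprime (q i) :=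
      coprime_add_one_of_dvd ((((dvd_pow_self (q i) (he i).ne').mul_right _).mul_left _).mul_left Q)
    rw [hcr i]
    exact (h1.coprime_dvd_right hBG).mul_right ((h1.coprime_dvd_right ⟨g i, hg i⟩).mul_right
      ((h2.pow_right _).mul_right (hQE i)))
  · have h1 : dk k (c i + 1) = (w + 1) * dk k (r i) := by
      rw [hcr i, dk_mul ((hrq i i).symm.pow_left _), dk_prime_pow (hq i).1]
      exact fun hd => (Nat.Prime.coprime_iff_not_dvd (hq i).1).1 (hqG i) (hd.trans hkG)
    have h2 : dk k (q i ^ e i) = e i + 1 :=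
      dk_prime_pow (hq i).1 fun hd =>
        (Nat.Prime.coprime_iff_not_dvd (hq i).1).1 (hqG i) (hd.trans hkG)
    have hqe : (q i ^ e i).Coprime (∏ l ∈ Finset.univ.erase i, u l) :=
      herase i fun l hl => Nat.Coprime.pow_left _
        (((hqq i l hl.symm).pow_right _).mul_right (hrq l i).symm)
    have hGx : G.Coprime (Q * (q i ^ e i * ∏ l ∈ Finset.univ.erase i, u l)) :=
      hQG.mul_right (((hqG i).symm.pow_right _).mul_right (herase i fun l _ => hGu l))
    have h3 : dk k (B * (Q * (G * g i * (q i ^ e i * ∏ l ∈ Finset.univ.erase i, u l)))) =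
        dk k (B * (G * g i)) * (dk k Q * ((e i + 1) *
          ∏ l ∈ Finset.univ.erase i, dk k (u l))) := by
      rw [← dk_prod k _ huu, ← h2, ← dk_mul hqe, ← dk_mul, ← dk_mul]
      · congr 1
        ring
      · exact (hGx.coprime_dvd_left hBG).mul_left (hgG i hGx)
      · exact ((hQq i).pow_right _).mul_right (herase i fun l _ => hQu l)
    rw [h3, h1, ← Finset.mul_prod_erase _ _ (Finset.mem_univ i), hdku i]
    have := hD i
    linear_combination ((w + 1) * dk k (r i) * dk k Q *
      ∏ l ∈ Finset.univ.erase i, dk k (u l)) * this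

theorem exists_weightedTuple {k B : ℕ} (hk : 0 < k) (hB : 0 < B) (N : ℕ) :
    ∃ a f : Fin N → ℕ, WeightedTuple k B a f := by
  suffices ∃ (ι : Type) (_ : Fintype ι), Fintype.card ι = N ∧
      ∃ a f : ι → ℕ, WeightedTuple k B a f by
    obtain ⟨ι, _, hcard, a, f, h⟩ := this
    let σ := (Fintype.equivFinOfCardEq hcard).symm
    exact ⟨a ∘ σ, f ∘ σ, fun i => h.pos _, fun i => h.weight_pos _,
      h.injective.comp σ.injective, fun i j => h.sub_dvd _ _, fun i j => h.weight_mul _ _⟩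
  induction N with
  | zero =>
    exact ⟨Empty, inferInstance, rfl, fun _ => 1, fun _ => 1, fun i => i.elim, fun i => i.elim,
      fun i => i.elim, fun i => i.elim, fun i => i.elim⟩
  | succ N ih =>
    obtain ⟨ι, _, hcard, a, f, h⟩ := ih
    obtain ⟨a', f', h'⟩ := h.exists_option hk hB
    exact ⟨Option ι, inferInstance, by rw [Fintype.card_option, hcard], a', f', h'⟩

theorem coprime_of_forall_prime_dvd_lt {L x Z : ℕ} (h : ∀ p, p.Prime → p ∣ L → Z < p)
    (hx : 0 < x) (hxZ : x ≤ Z) : L.Coprime x :=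
  Nat.coprime_of_dvd fun p hp hL hpx =>
    absurd ((h p hp hL).trans_le (Nat.le_of_dvd hx hpx)) (by omega)

theorem exists_mul_add_one_modEq {x s r : ℕ} (hs : 1 < s) (hr : 0 < r) (h : x.Coprime s) :
    ∃ y, x * y + 1 ≡ r [MOD s] := by
  obtain ⟨z, -, hz⟩ := Nat.exists_mul_mod_eq_one_of_coprime h hs
  have hz' : x * z ≡ 1 [MOD s] := hz.trans (Nat.mod_eq_of_lt hs).symm
  refine ⟨z * (r - 1), ?_⟩
  have := (hz'.mul_right (r - 1)).add_right 1
  rwa [one_mul, Nat.sub_add_cancel hr, mul_assoc] at this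

theorem WeightedTuple.exists_sievableForms {N k B : ℕ} {a f : Fin N → ℕ}
    (h : WeightedTuple k B a f) (hf : ∀ i, 2 ≤ f i) (hk : 0 < k) (hB : 0 < B) :
    ∃ (b : ℕ) (t : ℕ → ℕ) (q α γ : Fin N → ℕ), SievableForms N b α γ ∧
      (∀ i n, a i * t n + 1 = q i ^ (f i - 1) * (α i * n + γ i)) ∧
      (∀ i, (q i).Prime) ∧ (∀ i, q i ≤ 2 ^ 2 ^ b) ∧ (∀ i, (q i).Coprime k) ∧
      (∀ i, (q i).Coprime B) ∧ (∀ i j, (q i).Coprime (a j)) ∧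
      k ≤ 2 ^ 2 ^ b ∧ B ≤ 2 ^ 2 ^ b ∧ ∀ i, a i ≤ 2 ^ 2 ^ b := by
  classical
  obtain ⟨q, hqi, hq⟩ := exists_injective_prime_gt (Fin N) (k + B + ∑ i, a i)
  have hale : ∀ i, a i ≤ ∑ i, a i := fun i =>
    Finset.single_le_sum (fun j _ => Nat.zero_le (a j)) (Finset.mem_univ i)
  have hqle : ∀ i, q i ≤ ∑ i, q i := fun i =>
    Finset.single_le_sum (fun j _ => Nat.zero_le (q j)) (Finset.mem_univ i)
  have hqc : ∀ i x, 0 < x → x ≤ k + B + ∑ i, a i → (q i).Coprime x := fun i x hx hxle =>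
    (Nat.Prime.coprime_iff_not_dvd (hq i).1).2 fun hd =>
      absurd (Nat.le_of_dvd hx hd) (by have := (hq i).2; omega)
  have hqa : ∀ i j, (q i).Coprime (a j) := fun i j =>
    hqc i _ (h.pos j) (by have := hale j; omega)
  obtain ⟨b, hb⟩ : ∃ b, k + B + 2 * N + ∑ i, a i + ∑ i, q i ≤ 2 ^ 2 ^ b :=
    ⟨_, (Nat.lt_two_pow_self.trans Nat.lt_two_pow_self).le⟩
  set Y := 2 ^ 2 ^ b with hY
  set K := ∏ p ∈ (Finset.range (Y + 1)).filter fun p => p.Prime ∧ ∀ i, q i ≠ p, p with hK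
  have hpK : ∀ p, p.Prime → p ≤ Y → (∀ i, q i ≠ p) → p ∣ K := fun p hp hpY hpq =>
    Finset.dvd_prod_of_mem _ (Finset.mem_filter.2 ⟨Finset.mem_range.2 (by omega), hp, hpq⟩)
  have hKq : ∀ i, K.Coprime (q i) := fun i => Nat.Coprime.prod_left fun p hp => by
    obtain ⟨-, hp, hpq⟩ := Finset.mem_filter.1 hp
    exact (Nat.coprime_primes hp (hq i).1).2 (hpq i).symm
  obtain ⟨t₀, ht₀, ht⟩ : ∃ t₀, t₀ ≡ 0 [MOD K] ∧
      ∀ i, a i * t₀ + 1 ≡ q i ^ (f i - 1) [MOD q i ^ f i] := by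
    choose y hy using fun i => exists_mul_add_one_modEq (x := a i) (s := q i ^ f i)
      (Nat.one_lt_pow (by have := hf i; omega) (hq i).1.one_lt)
      (pow_pos (hq i).1.pos (f i - 1)) ((hqa i i).symm.pow_right _)
    obtain ⟨x, hx, hxi⟩ := exists_modEq_and_forall_modEq (M := K) (s := fun i => q i ^ f i)
      (fun i => (pow_pos (hq i).1.pos _).ne')
      (fun i j hij => Nat.Coprime.pow _ _
        ((Nat.coprime_primes (hq i).1 (hq j).1).2 (hqi.ne hij)))
      (fun i => (hKq i).pow_right _) 0 y
    exact ⟨x, hx, fun i => (((hxi i).mul_left _).add_right 1).trans (hy i)⟩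
  have hK0 : 0 < K := Finset.prod_pos fun p hp => (Finset.mem_filter.1 hp).2.1.pos
  set H := K * ∏ i, q i ^ f i with hH
  have hH0 : 0 < H := Nat.mul_pos hK0 (Finset.prod_pos fun i _ => pow_pos (hq i).1.pos _)
  have hqH : ∀ i, q i ^ f i ∣ H := fun i =>
    (Finset.dvd_prod_of_mem (fun i => q i ^ f i) (Finset.mem_univ i)).mul_left K
  have hdvdH : ∀ p, p.Prime → p ∣ H → p ≤ Y := fun p hp hd => by
    rcases (Nat.Prime.dvd_mul hp).1 hd with hd | hd
    · obtain ⟨l, hl, hpl⟩ := (Prime.dvd_finsetProd_iff hp.prime _).1 hd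
      obtain ⟨hl, hl', -⟩ := Finset.mem_filter.1 hl
      rw [(Nat.prime_dvd_prime_iff_eq hp hl').1 hpl]
      exact Nat.lt_succ_iff.1 (Finset.mem_range.1 hl)
    · obtain ⟨l, -, hpl⟩ := (Prime.dvd_finsetProd_iff hp.prime _).1 hd
      rw [(Nat.prime_dvd_prime_iff_eq hp (hq l).1).1 (hp.dvd_of_dvd_pow hpl)]
      have := hqle l
      omega
  set t : ℕ → ℕ := fun n => t₀ + H * (n + 1) with htdef
  have htK : ∀ n, K ∣ t n := fun n =>
    dvd_add (Nat.modEq_zero_iff_dvd.1 ht₀) ((dvd_mul_right K _).mul_right _)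
  have hmod : ∀ i n, a i * t n + 1 ≡ q i ^ (f i - 1) [MOD q i ^ (f i - 1 + 1)] := fun i n => by
    rw [Nat.sub_add_cancel (by have := hf i; omega)]
    refine Nat.ModEq.trans ?_ (ht i)
    have h1 : a i * (H * (n + 1)) ≡ 0 [MOD q i ^ f i] :=
      Nat.modEq_zero_iff_dvd.2 (((hqH i).mul_right _).mul_left _)
    have h2 := (h1.add_left (a i * t₀)).add_right 1
    rwa [← mul_add] at h2
  choose γ hγ _ using fun i => exists_eq_pow_mul_of_modEq (hq i).1.one_lt (hmod i 0)
  choose α hα using fun i =>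
    (((pow_dvd_pow (q i) (Nat.sub_le (f i) 1)).trans (hqH i)).mul_left (a i))
  have hform : ∀ i n, a i * t n + 1 = q i ^ (f i - 1) * (α i * n + γ i) := fun i n => by
    have h1 : q i ^ (f i - 1) * (α i * n + γ i) =
        q i ^ (f i - 1) * α i * n + q i ^ (f i - 1) * γ i := by ring
    rw [h1, ← hα, ← hγ]
    simp only [htdef]
    ring
  have hdvd : ∀ {i n p}, p ∣ α i * n + γ i → p ∣ a i * t n + 1 := fun {i n p} hp => by
    rw [hform]
    exact hp.mul_left _
  have hcop : ∀ {i n p}, p.Prime → p ∣ a i * t n + 1 → ¬p ∣ t n := fun {i n p} hp h1 h2 =>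
    hp.one_lt.ne' (Nat.dvd_one.1 ((Nat.dvd_add_right (h2.mul_left (a i))).1 h1))
  have hdvda : ∀ {i j n p}, p.Prime → a i < a j → p ∣ a i * t n + 1 → p ∣ a j * t n + 1 →
      p ∣ a i := fun {i j n p} hp hij hi hj => by
    have h1 := Nat.dvd_sub hj hi
    rw [Nat.add_sub_add_right, ← Nat.sub_mul] at h1
    exact ((Nat.Prime.dvd_mul hp).1 h1).resolve_right (hcop hp hi) |>.trans (h.sub_dvd i j hij)
  have hdvda' : ∀ {i j n p}, p.Prime → i ≠ j → p ∣ a i * t n + 1 → p ∣ a j * t n + 1 →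
      ∃ l, p ∣ a l := fun {i j n p} hp hij hi hj => by
    rcases lt_or_gt_of_ne (h.injective.ne hij) with h1 | h1
    · exact ⟨i, hdvda hp h1 hi hj⟩
    · exact ⟨j, hdvda hp h1 hj hi⟩
  refine ⟨b, t, q, α, γ, ⟨by omega, fun i => ?_, fun p hp i n hpd => ?_, fun p hp hpY i hd => ?_,
    fun p hp hpY n i j hi hj => ?_⟩, hform, fun i => (hq i).1, fun i => ?_,
    fun i => hqc i k hk (by omega), fun i => hqc i B hB (by omega), hqa, by omega, by omega,
    fun i => ?_⟩
  · have h1 : q i ^ (f i - 1) ≤ H :=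
      Nat.le_of_dvd hH0 ((pow_dvd_pow (q i) (Nat.sub_le (f i) 1)).trans (hqH i))
    have h2 : H ≤ a i * t 0 := by
      calc H = 1 * H := (one_mul H).symm
        _ ≤ a i * t 0 := Nat.mul_le_mul (h.pos i) (by simp only [htdef]; omega)
    have h3 := hγ i
    by_contra! h4
    have h5 : q i ^ (f i - 1) * γ i ≤ q i ^ (f i - 1) * 1 := Nat.mul_le_mul_left _ h4
    omega
  · by_contra! hpY
    by_cases hpq : ∃ l, q l = p
    · obtain ⟨l, rfl⟩ := hpq
      obtain ⟨r, hr, hqr⟩ := exists_eq_pow_mul_of_modEq (hq l).1.one_lt (hmod l n)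
      rcases eq_or_ne i l with rfl | hil
      · rw [hform] at hr
        rw [← Nat.eq_of_mul_eq_mul_left (pow_pos (hq i).1.pos _) hr] at hqr
        exact hqr hpd
      · have h1 : q l ∣ a l * t n + 1 := by
          rw [hr]
          exact (dvd_pow_self _ (by have := hf l; omega)).mul_right _
        obtain ⟨m, hm⟩ := hdvda' hp hil (hdvd hpd) h1
        exact (Nat.Prime.coprime_iff_not_dvd hp).1 (hqa l m) hm
    · push Not at hpq
      exact hcop hp (hdvd hpd) ((hpK p hp hpY hpq).trans (htK n))
  · have h1 : p ∣ a i * H := by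
      rw [hα]
      exact hd.mul_left _
    rcases (Nat.Prime.dvd_mul hp).1 h1 with h1 | h1
    · have := Nat.le_of_dvd (h.pos i) h1
      have := hale i
      omega
    · have := hdvdH p hp h1
      omega
  · by_contra hij
    obtain ⟨l, hl⟩ := hdvda' hp hij (hdvd hi) (hdvd hj)
    have := Nat.le_of_dvd (h.pos l) hl
    have := hale l
    omega
  · have := hqle i
    omega
  · have := hale i
    omega

theorem dk_eq_dk_add_infinitely_often (k B : ℕ) (hk : 0 < k) (hB : 0 < B) :
    {n : ℕ | 0 < n ∧ dk k n = dk k (n + B)}.Infinite := by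
  obtain ⟨a, g, h, hf⟩ : ∃ a g : Fin 1024 → ℕ, WeightedTuple k B a g ∧ ∀ i, 2 ≤ g i := by
    obtain ⟨a, f, h⟩ := exists_weightedTuple hk hB 1024
    exact ⟨a, _, h.const_mul two_pos, fun i => Nat.mul_le_mul_left 2 (h.weight_pos i)⟩
  obtain ⟨b, t, q, α, γ, hS, hform, hq, hqY, hqk, hqB, hqa, hkY, hBY, haY⟩ :=
    h.exists_sievableForms hf hk hB
  have hlarge := fun i n p hp => hS.lt_of_dvd p hp i n
  have hcop : ∀ i n x, 0 < x → x ≤ 2 ^ 2 ^ b → (α i * n + γ i).Coprime x := fun i n x =>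
    coprime_of_forall_prime_dvd_lt (hlarge i n)
  have hdk : ∀ i n, Squarefree (α i * n + γ i) →
      dk k (a i * t n + 1) = g i * 2 ^ (α i * n + γ i).primeFactors.card := fun i n hsq => by
    rw [hform, dk_mul ((hcop i n _ (hq i).pos (hqY i)).symm.pow_left _), dk_prime_pow (hq i),
      dk_of_squarefree hsq (hcop i n k hk hkY), Nat.sub_add_cancel (by have := hf i; omega)]
    exact (Nat.Prime.coprime_iff_not_dvd (hq i)).1 (hqk i)
  have hcop' : ∀ i j n d, d ∣ a j → (B * (a j / d)).Coprime (a i * t n + 1) := fun i j n d hd => by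
    have hda := Nat.div_dvd_of_dvd hd
    rw [hform]
    refine Nat.Coprime.mul_left (Nat.Coprime.mul_right ?_ ?_) (Nat.Coprime.mul_right ?_ ?_)
    · exact (hqB i).symm.pow_right _
    · exact (hcop i n B hB hBY).symm
    · exact ((hqa i j).symm.pow_right _).coprime_dvd_left hda
    · exact (hcop i n _ (h.pos j) (haY j)).symm.coprime_dvd_left hda
  refine Set.infinite_of_forall_exists_gt fun Z => ?_
  obtain ⟨n, hsq, hZ, i, j, hij, hcard⟩ :=
    hS.exists_card_primeFactors_eq (s := 18) (by norm_num) (by norm_num) Z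
  wlog hlt : a i < a j generalizing i j
  · exact this j i hij.symm hcard.symm
      (lt_of_le_of_ne (not_lt.1 hlt) (h.injective.ne hij).symm)
  have hd := h.sub_dvd i j hlt
  have hd' := h.sub_dvd_right hlt
  have hdpos : 0 < a j - a i := Nat.sub_pos_of_lt hlt
  have hadd : B * (a i / (a j - a i)) * (a j * t n + 1) + B =
      B * (a j / (a j - a i)) * (a i * t n + 1) := by
    obtain ⟨u, hu⟩ := hd
    have hj : a j = (a j - a i) * (u + 1) := by
      rw [mul_add, ← hu]
      omega
    have e1 : a i / (a j - a i) = u := Nat.div_eq_of_eq_mul_right hdpos hu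
    have e2 : a j / (a j - a i) = u + 1 := Nat.div_eq_of_eq_mul_right hdpos hj
    rw [e1, e2]
    generalize a j - a i = d at *
    rw [hu, hj]
    ring
  refine ⟨B * (a i / (a j - a i)) * (a j * t n + 1), ⟨?_, ?_⟩, ?_⟩
  · exact Nat.mul_pos (Nat.mul_pos hB (Nat.div_pos (Nat.le_of_dvd (h.pos i) hd) hdpos))
      (Nat.succ_pos _)
  · rw [hadd, dk_mul (hcop' j i n _ hd), dk_mul (hcop' i j n _ hd'), hdk j n (hsq j),
      hdk i n (hsq i), hcard]
    have := h.weight_mul i j hlt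
    linear_combination 2 ^ (α j * n + γ j).primeFactors.card * this
  · obtain ⟨p, hp, hpd⟩ := Nat.exists_prime_and_dvd
      (n := α j * n + γ j) (by have := hS.one_lt j; omega)
    refine (hZ j p hp hpd).trans_le (Nat.le_of_dvd ?_ ?_)
    · exact Nat.mul_pos (Nat.mul_pos hB (Nat.div_pos (Nat.le_of_dvd (h.pos i) hd) hdpos))
        (Nat.succ_pos _)
    · rw [hform]
      exact (hpd.mul_left _).mul_left _
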